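/- There is no algorithm (no total computable function, for any fixed effective encoding of instances by natural numbers) that, given a 2-dimensional affine graph-directed iterated function system with 3 vertices whose maps are contracting affine maps with rational coefficients and in which every vertex has at least one outgoing edge, together with a distinguished vertex q, decides whether the attractor component X_q equals the unit square [0,1]². -/

import Mathlib

/-- An edge of a 2-dimensional affine GIFS on 3 vertices with rational coefficients:
source vertex, target vertex, rational 2×2 matrix, rational translation vector. -/
abbrev GifsEdge : Type := Fin 3 × Fin 3 × (Fin 2 → Fin 2 → ℚ) × (Fin 2 → ℚ)

/-- The affine map `x ↦ M x + v` on ℝ² determined by a rational matrix and vector. -/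
noncomputable def gifsEdgeMap (M : Fin 2 → Fin 2 → ℚ) (v : Fin 2 → ℚ) :
    EuclideanSpace ℝ (Fin 2) → EuclideanSpace ℝ (Fin 2) :=
  fun x => (WithLp.equiv 2 (Fin 2 → ℝ)).symm
    (fun i => (∑ j, (M i j : ℝ) * x j) + (v i : ℝ))

/-- A map on ℝ² is contracting: Lipschitz with some constant `c < 1`. -/
def IsContractingMap (f : EuclideanSpace ℝ (Fin 2) → EuclideanSpace ℝ (Fin 2)) : Prop :=
  ∃ c : NNReal, c < 1 ∧ LipschitzWith c f

/-- Well-formed instance: every edge map is contracting and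
every vertex has at least one outgoing edge. -/
def GifsWF (L : List GifsEdge) : Prop :=
  (∀ e ∈ L, IsContractingMap (gifsEdgeMap e.2.2.1 e.2.2.2)) ∧
  (∀ q : Fin 3, ∃ e ∈ L, e.1 = q)

/-- `X` is the family of attractors of the GIFS: a family of nonempty compact sets
satisfying the graph-directed fixed-point equations. -/
def IsGifsAttractor (L : List GifsEdge) (X : Fin 3 → Set (EuclideanSpace ℝ (Fin 2))) : Prop :=
  (∀ q, (X q).Nonempty ∧ IsCompact (X q)) ∧
  (∀ q, X q = ⋃ e ∈ L, ⋃ (_ : e.1 = q), gifsEdgeMap e.2.2.1 e.2.2.2 '' X e.2.1)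

/-- The unit square `[0,1]²` in ℝ². -/
def UnitSquare : Set (EuclideanSpace ℝ (Fin 2)) := {x | ∀ i, x i ∈ Set.Icc (0 : ℝ) 1}

/-! ### Computability of rational-valued sequences -/

section RationalCode

open Encodable

theorem encode_ofEncodableOfInfinite {α : Type*} [Encodable α] [Infinite α]
    [DecidablePred fun n => n ∈ Set.range (encode : α → ℕ)] (x : α) :
    (Denumerable.ofEncodableOfInfinite α).encode x =
      ((List.range (encode x)).filter (fun n => n ∈ Set.range (encode : α → ℕ))).length := by
  rw [← List.countP_eq_length_filter]
  refine Eq.trans (b := (List.range (encode x)).countP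
    (fun n => @decide _ (decidableRangeEncode α n))) rfl ?_
  congr!

theorem Int.encode_eq (z : ℤ) : encode z = Equiv.intEquivNat z := rfl

theorem Rat.encode_sigma (q : ℚ) :
    @encode ℚ Rat.instEncodable q = Nat.pair (encode q.num) q.den := rfl

theorem Int.natAbs_intEquivNat_symm (m : ℕ) :
    (Equiv.intEquivNat.symm m).natAbs = (m + 1) / 2 := by
  obtain ⟨z, rfl⟩ := Equiv.intEquivNat.surjective m
  rw [Equiv.symm_apply_apply]
  cases z with
  | ofNat n =>
    rw [show Equiv.intEquivNat (Int.ofNat n) = 2 * n from rfl]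
    simp; omega
  | negSucc n =>
    rw [show Equiv.intEquivNat (Int.negSucc n) = 2 * n + 1 from rfl]
    simp; omega

theorem Rat.mem_range_encode_iff (m : ℕ) :
    m ∈ Set.range (@encode ℚ Rat.instEncodable) ↔
      0 < m.unpair.2 ∧ Nat.gcd ((m.unpair.1 + 1) / 2) m.unpair.2 = 1 := by
  constructor
  · rintro ⟨q, rfl⟩
    rw [Rat.encode_sigma, Nat.unpair_pair, Int.encode_eq, ← Int.natAbs_intEquivNat_symm,
      Equiv.symm_apply_apply]
    exact ⟨q.pos, q.reduced⟩
  · rintro ⟨h0, h1⟩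
    rw [← Int.natAbs_intEquivNat_symm] at h1
    refine ⟨⟨_, _, h0.ne', h1⟩, ?_⟩
    rw [Rat.encode_sigma, Int.encode_eq, Equiv.apply_symm_apply, Nat.pair_unpair]

theorem Primrec.nat_gcd : Primrec₂ Nat.gcd := by
  have hdvd : PrimrecRel fun (p : ℕ × ℕ) (k : ℕ) => p.1 % k = 0 ∧ p.2 % k = 0 := by
    refine PrimrecPred.and ?_ ?_
    · exact Primrec.eq.comp (Primrec.nat_mod.comp (Primrec.fst.comp Primrec.fst) Primrec.snd)
        (Primrec.const 0)
    · exact Primrec.eq.comp (Primrec.nat_mod.comp (Primrec.snd.comp Primrec.fst) Primrec.snd)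
        (Primrec.const 0)
  refine (Primrec.nat_findGreatest (f := fun p : ℕ × ℕ => p.1 + p.2)
    (Primrec.nat_add.comp Primrec.fst Primrec.snd) hdvd).of_eq ?_
  rintro ⟨a, b⟩
  rw [Nat.findGreatest_eq_iff]
  refine ⟨?_, fun _ => ?_, fun n hn _ ⟨h1, h2⟩ => ?_⟩
  · rcases Nat.eq_zero_or_pos a with rfl | ha
    · simp
    · exact (Nat.gcd_le_left b ha).trans (Nat.le_add_right _ _)
  · exact ⟨Nat.mod_eq_zero_of_dvd (Nat.gcd_dvd_left a b),
      Nat.mod_eq_zero_of_dvd (Nat.gcd_dvd_right a b)⟩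
  · have hd := Nat.dvd_gcd (Nat.dvd_of_mod_eq_zero h1) (Nat.dvd_of_mod_eq_zero h2)
    rcases Nat.eq_zero_or_pos (a.gcd b) with h0 | h0
    · obtain ⟨rfl, rfl⟩ := Nat.gcd_eq_zero_iff.1 h0
      simp at *
      omega
    · exact absurd (Nat.le_of_dvd h0 hd) (not_le.2 hn)

theorem Primrec.rat_div {a b : ℕ → ℕ} (ha : Primrec a) (hb : Primrec b) (hpos : ∀ n, 0 < b n) :
    Primrec fun n => (a n : ℚ) / (b n : ℚ) := by
  classical
  have hp : PrimrecPred fun m : ℕ => m ∈ Set.range (@encode ℚ Rat.instEncodable) := by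
    refine PrimrecPred.of_eq (PrimrecPred.and (Primrec.nat_lt.comp (Primrec.const 0)
      (Primrec.snd.comp Primrec.unpair)) (Primrec.eq.comp (Primrec.nat_gcd.comp
        (Primrec.nat_div.comp (Primrec.succ.comp (Primrec.fst.comp Primrec.unpair))
          (Primrec.const 2)) (Primrec.snd.comp Primrec.unpair)) (Primrec.const 1)))
      fun m => (Rat.mem_range_encode_iff m).symm
  rw [← Primrec.encode_iff]
  have hg : Primrec fun n => (a n).gcd (b n) := Primrec.nat_gcd.comp ha hb
  refine (Primrec.list_length.comp ((Primrec.listFilter hp).comp (Primrec.list_range.comp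
    (Primrec₂.natPair.comp (Primrec.nat_mul.comp (Primrec.const 2) (Primrec.nat_div.comp ha hg))
      (Primrec.nat_div.comp hb hg))))).of_eq fun n => ?_
  refine Eq.trans ?_ (@encode_ofEncodableOfInfinite ℚ Rat.instEncodable _ _ _).symm
  have hgpos : 0 < (a n).gcd (b n) := Nat.gcd_pos_of_pos_right _ (hpos n)
  have hbpos : 0 < b n / (a n).gcd (b n) :=
    Nat.div_pos (Nat.le_of_dvd (hpos n) (Nat.gcd_dvd_right _ _)) hgpos
  have hcop := Nat.coprime_div_gcd_div_gcd hgpos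
  have hq : (a n : ℚ) / (b n : ℚ) =
      (((a n / (a n).gcd (b n) : ℕ) : ℤ) : ℚ) / (((b n / (a n).gcd (b n) : ℕ) : ℤ) : ℚ) := by
    have h0 : ((a n).gcd (b n) : ℚ) ≠ 0 := by exact_mod_cast hgpos.ne'
    rw [Int.cast_natCast, Int.cast_natCast, Nat.cast_div (Nat.gcd_dvd_left _ _) h0,
      Nat.cast_div (Nat.gcd_dvd_right _ _) h0, div_div_div_cancel_right₀ h0]
  rw [hq, Rat.encode_sigma]
  generalize a n / (a n).gcd (b n) = c at hcop
  generalize b n / (a n).gcd (b n) = d at hcop hbpos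
  have hnum := Rat.num_div_eq_of_coprime (a := c) (b := d) (by exact_mod_cast hbpos) (by simpa)
  have hden := Rat.den_div_eq_of_coprime (a := c) (b := d) (by exact_mod_cast hbpos) (by simpa)
  rw [hnum, Nat.cast_inj.1 hden]
  congr!

end RationalCode

/-! ### A fixed Turing machine with an undecidable halting problem -/

section FixedMachine

open Turing

theorem Turing.TM0.Supports.exists_finite {Γ Λ : Type} [Inhabited Γ] [Inhabited Λ]
    (M : TM0.Machine Γ Λ) (S : Finset Λ) (ss : TM0.Supports M S) :
    ∃ (Q : Type) (_ : Inhabited Q) (_ : Finite Q) (N : TM0.Machine Γ Q),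
      ∀ l, (TM0.eval N l).Dom ↔ (TM0.eval M l).Dom := by
  classical
  let Q : Type := {q // q ∈ S}
  let _ : Inhabited Q := ⟨⟨default, ss.1⟩⟩
  let g₁ : PointedMap Λ Q := ⟨fun q => if h : q ∈ S then ⟨q, h⟩ else default, by
    have h : (default : Λ) ∈ S := ss.1
    simp [h]; rfl⟩
  let f : PointedMap Γ Γ := ⟨id, rfl⟩
  refine ⟨Q, inferInstance, inferInstance, M.map f f g₁ Subtype.val, fun l => ?_⟩
  have hr := TM0.Machine.map_respects M f f g₁ Subtype.val ss (fun _ => rfl)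
    (fun q hq => by
      have h : q ∈ S := hq
      change ((if h : q ∈ S then (⟨q, h⟩ : Q) else default) : Q).val = q
      rw [dif_pos h])
  have hi := TM0.map_init f g₁ l
  have hl : l.map f = l := List.map_id l
  rw [hl] at hi
  exact StateTransition.tr_eval_dom hr ⟨ss.1, hi⟩

theorem Turing.TM2.Supports.exists_TM0 {K : Type} [DecidableEq K] {Γ : K → Type}
    {Λ σ : Type} [Inhabited Λ] [Inhabited σ] [Finite σ] (M : Λ → TM2.Stmt Γ Λ σ)
    (S : Finset Λ) (ss : TM2.Supports M S) :
    ∃ (Q : Type) (_ : Inhabited Q) (_ : Finite Q) (N : TM0.Machine (TM2to1.Γ' K Γ) Q),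
      ∀ k L, (TM0.eval N (TM2to1.trInit k L)).Dom ↔ (TM2.eval M k L).Dom := by
  classical
  have := Fintype.ofFinite σ
  obtain ⟨Q, i, j, N, hN⟩ := TM0.Supports.exists_finite _ _
    (TM1to0.tr_supports _ (TM2to1.tr_supports M ss))
  refine ⟨Q, i, j, N, fun k L => ?_⟩
  rw [hN, TM1to0.tr_eval, TM2to1.tr_eval_dom]

theorem Turing.PartrecToTM2.trPosNum_two_pow (k : ℕ) :
    PartrecToTM2.trNat (2 ^ k) =
      List.replicate k PartrecToTM2.Γ'.bit0 ++ [PartrecToTM2.Γ'.bit1] := by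
  have h : ∃ p : PosNum, (p : ℕ) = 2 ^ k ∧ PartrecToTM2.trPosNum p =
      
      List.replicate k PartrecToTM2.Γ'.bit0 ++ [PartrecToTM2.Γ'.bit1] := by
    induction k with
    | zero => exact ⟨1, by simp, rfl⟩
    | succ k ih =>
      obtain ⟨p, hp, hw⟩ := ih
      refine ⟨p.bit0, ?_, ?_⟩
      · rw [PosNum.cast_bit0, hp, pow_succ]; ring
      · rw [PartrecToTM2.trPosNum, hw]; rfl
  obtain ⟨p, hp, hw⟩ := h
  rw [← hp, PartrecToTM2.trNat, ← hw]
  have : ((p : ℕ) : Num) = Num.pos p := by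
    have := Num.of_to_nat (Num.pos p)
    simp
  rw [this]; rfl

theorem exists_undecidable_partrec :
    ∃ F : ℕ →. ℕ, Partrec F ∧ ¬ ComputablePred fun k => (F (2 ^ k)).Dom := by
  let G : ℕ →. ℕ := fun k => (Denumerable.ofNat Nat.Partrec.Code k).eval 0
  have hG : Partrec G := by
    refine Nat.Partrec.Code.eval_part.comp (Computable.ofNat _) (Computable.const 0)
  let F : ℕ →. ℕ := fun n => (Nat.rfind fun k => (decide (2 ^ k = n) : Bool)).bind G
  have hpow : Primrec fun k : ℕ => 2 ^ k :=
    (Primrec.nat_rec₁ 1 (Primrec.nat_mul.comp₂ (Primrec₂.right)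
      (Primrec.const 2).to₂)).of_eq fun k => by
        induction k with
        | zero => rfl
        | succ k ih => rw [pow_succ, ← ih]
  have hF : Partrec F := by
    refine Partrec.bind (Partrec.rfind (p := fun n k => (decide (2 ^ k = n) : Bool)) ?_) ?_
    · refine Computable.partrec ?_
      exact (Primrec.eq.comp (hpow.comp Primrec.snd) Primrec.fst).decide.to_comp
    · exact hG.comp Computable.snd
  refine ⟨F, hF, fun h => ComputablePred.halting_problem 0 ?_⟩
  refine ComputablePred.computable_of_manyOneReducible
    ⟨Encodable.encode, Computable.encode, fun c => ?_⟩ h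
  have : F (2 ^ Encodable.encode c) = c.eval 0 := by
    have h1 : Nat.rfind (fun k => (decide (2 ^ k = 2 ^ Encodable.encode c) : Bool)) =
        Part.some (Encodable.encode c) := by
      refine Part.eq_some_iff.2 (Nat.mem_rfind.2 ⟨?_, fun {m} hm => ?_⟩)
      · simp
      · have : m ≠ Encodable.encode c := hm.ne
        simpa using this
    change (Nat.rfind _).bind G = _
    rw [h1, Part.bind_some]
    rw [Denumerable.ofNat_encode]
  simp only [this]

/-- There is a Turing machine whose halting problem is undecidable on the inputs consisting of
two fixed letters followed by a repeated one. -/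
theorem exists_undecidable_TM0 :
    ∃ (Γ Q : Type) (_ : Inhabited Γ) (_ : Finite Γ) (_ : Inhabited Q) (_ : Finite Q)
      (M : TM0.Machine Γ Q) (b c d : Γ),
      ¬ ComputablePred fun k => (TM0.eval M (b :: c :: List.replicate k d)).Dom := by
  obtain ⟨F, hF, hund⟩ := exists_undecidable_partrec
  obtain ⟨c, hc⟩ := ToPartrec.Code.exists_code (Nat.Partrec'.part_iff₁.2 hF)
  let _ : Inhabited PartrecToTM2.Λ' := ⟨PartrecToTM2.trNormal c .halt⟩
  obtain ⟨Q, hQ, hQf, M, hM⟩ := TM2.Supports.exists_TM0 PartrecToTM2.tr _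
    (PartrecToTM2.tr_supports c .halt)
  let _ : Fintype PartrecToTM2.K' := ⟨{.main, .rev, .aux, .stack}, fun x => by cases x <;> simp⟩
  let e : PartrecToTM2.Γ' → TM2to1.Γ' PartrecToTM2.K' (fun _ => PartrecToTM2.Γ') :=
    fun a => (false, Function.update (fun _ => none) .main (some a))
  refine ⟨_, Q, inferInstance, inferInstance, hQ, hQf, M,
    (true, (e .cons).2), e .bit1, e .bit0, fun h => hund (h.of_eq fun k => ?_)⟩
  have hin : ((true, (e .cons).2) :: e .bit1 :: List.replicate k (e .bit0) :
        List (TM2to1.Γ' PartrecToTM2.K' fun _ => PartrecToTM2.Γ')) =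
      TM2to1.trInit (Γ := fun _ => PartrecToTM2.Γ') PartrecToTM2.K'.main
        (PartrecToTM2.trList [2 ^ k]) := by
    have hL : (PartrecToTM2.trList [2 ^ k]).reverse =
        .cons :: .bit1 :: List.replicate k .bit0 := by
      simp [PartrecToTM2.trList, PartrecToTM2.trPosNum_two_pow]
    have he : List.replicate k (e .bit0) = (List.replicate k .bit0).map e :=
      List.map_replicate.symm
    unfold TM2to1.trInit
    rw [hL, he]
    rfl
  rw [hin, hM]
  have hi : TM2.init PartrecToTM2.K'.main (PartrecToTM2.trList [2 ^ k]) =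
      PartrecToTM2.init c [2 ^ k] := by
    refine congrArg (TM2.Cfg.mk _ _) ?_
    funext x
    cases x <;> rfl
  have hv := hc (⟨[2 ^ k], rfl⟩ : List.Vector ℕ 1)
  have : (TM2.eval PartrecToTM2.tr PartrecToTM2.K'.main (PartrecToTM2.trList [2 ^ k])).Dom ↔
      (StateTransition.eval (TM2.step PartrecToTM2.tr) (PartrecToTM2.init c [2 ^ k])).Dom := by
    rw [← hi]; rfl
  rw [this, PartrecToTM2.tr_eval]
  change (ToPartrec.Code.eval c _).Dom ↔ _
  rw [hv]
  rfl

end FixedMachine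

/-! ### Computations of a Turing machine as solutions of a correspondence problem -/

section Correspondence

open Turing

/-- Two words are comparable if one of them begins with the other. -/
def PrefixComparable {A : Type*} (u v : List A) : Prop := u <+: v ∨ v <+: u

/-- The pairs obtained by concatenating finitely many pairs of words from `R`. -/
inductive WordGen {A : Type*} (R : List A → List A → Prop) : List A → List A → Prop
  | nil : WordGen R [] []
  | cons {l r w z : List A} : R l r → WordGen R w z → WordGen R (l ++ w) (r ++ z)

/-- The correspondence problem for the rules `R`, the holes `H` and the word `s`: find a
product `(w, z)` of rules such that `s ++ z` starts with `w` followed by a hole. -/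
def WordMatch {A : Type*} (R : List A → List A → Prop) (H : List A → Prop) (s : List A) : Prop :=
  ∃ w z l, WordGen R w z ∧ H l ∧ w ++ l <+: s ++ z

theorem WordGen.single_cons {A : Type*} {R : List A → List A → Prop} {a b : A} {w z : List A}
    (h : R [a] [b]) (hw : WordGen R w z) : WordGen R (a :: w) (b :: z) :=
  WordGen.cons h hw

theorem WordGen.copy_append {A : Type*} {R : List A → List A → Prop} {u w z : List A}
    (h : ∀ a ∈ u, R [a] [a]) (hw : WordGen R w z) : WordGen R (u ++ w) (u ++ z) := by
  induction u with
  | nil => exact hw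
  | cons a u ih =>
    exact .single_cons (h a (by simp)) (ih fun b hb => h b (by simp [hb]))

/-- The letters of the words that describe the computations of a Turing machine. -/
inductive TMLetter (Γ Q : Type)
  | tape (a : Γ)
  | state (q : Q)
  | sep
  | mark

variable {Γ Q : Type}

namespace TMLetter

instance [Finite Γ] [Finite Q] : Finite (TMLetter Γ Q) :=
  Finite.of_injective (β := Γ ⊕ Q ⊕ Bool)
    (fun l => match l with
      | tape a => .inl a
      | state q => .inr (.inl q)
      | sep => .inr (.inr true)
      | mark => .inr (.inr false))
    (by rintro (_ | _ | _ | _) (_ | _ | _ | _) h <;> simp_all)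

end TMLetter

open TMLetter

/-- The pairs of words that describe the action of a Turing machine near its head. -/
inductive HeadRule [Inhabited Q] (M : TM0.Machine Γ Q) :
    List (TMLetter Γ Q) → List (TMLetter Γ Q) → Prop
  | write {q a q' b} : M q a = some (q', .write b) →
      HeadRule M [state q, tape a] [state q', tape b]
  | right {q a q'} : M q a = some (q', .move .right) →
      HeadRule M [state q, tape a] [tape a, state q']
  | left {q a q'} (c : Γ) : M q a = some (q', .move .left) →
      HeadRule M [tape c, state q, tape a] [state q', tape c, tape a]

theorem HeadRule.exists_of_ne_none [Inhabited Q] {M : TM0.Machine Γ Q} {u : List Γ} {q : Q} {a : Γ}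
    (hu : u ≠ []) (h : M q a ≠ none) :
    ∃ U : List Γ, ∃ l r, HeadRule M l r ∧
      u.reverse.map tape ++ [state q, tape a] = U.map tape ++ l := by
  obtain ⟨⟨q', s⟩, hs⟩ := Option.ne_none_iff_exists'.1 h
  obtain ⟨c, u, rfl⟩ := List.exists_cons_of_ne_nil hu
  rcases s with (_ | _) | b
  · exact ⟨u.reverse, _, _, .left c hs, by simp⟩
  · exact ⟨(c :: u).reverse, _, _, .right hs, rfl⟩
  · exact ⟨(c :: u).reverse, _, _, .write hs, rfl⟩

variable [Inhabited Γ]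

/-- The configuration with tape `u.reverse`, `a`, `v` and state `q`. -/
def tmCfg (u : List Γ) (q : Q) (a : Γ) (v : List Γ) : TM0.Cfg Γ Q :=
  ⟨q, ⟨a, ListBlank.mk u, ListBlank.mk v⟩⟩

/-- The word describing a configuration. -/
def tmWord (u : List Γ) (q : Q) (a : Γ) (v : List Γ) : List (TMLetter Γ Q) :=
  u.reverse.map tape ++ state q :: tape a :: v.map tape

theorem ListBlank.mk_append_default (u : List Γ) :
    ListBlank.mk (u ++ [default]) = ListBlank.mk u :=
  Quotient.sound (Or.inr ⟨1, rfl⟩)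

theorem tmWord_eq_cons (u : List Γ) (q : Q) (a : Γ) (v : List Γ) :
    tmWord (u ++ [default]) q a (v ++ [default]) =
      tape default :: tmWord u q a v ++ [tape default] := by
  simp [tmWord]

theorem tmCfg_eq_append (u : List Γ) (q : Q) (a : Γ) (v : List Γ) :
    tmCfg (u ++ [default]) q a (v ++ [default]) = tmCfg u q a v := by
  simp [tmCfg, ListBlank.mk_append_default]

variable [Inhabited Q]

/-- The pairs of words that transform a configuration into the next one. -/
inductive TMRule (M : TM0.Machine Γ Q) :
    List (TMLetter Γ Q) → List (TMLetter Γ Q) → Prop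
  | copy (a : Γ) : TMRule M [tape a] [tape a]
  | sep : TMRule M [sep] [tape default, sep, tape default]
  | head {l r} : HeadRule M l r → TMRule M l r

/-- The words that mark the end of a computation. -/
inductive TMHole (M : TM0.Machine Γ Q) : List (TMLetter Γ Q) → Prop
  | halt {q a} : M q a = none → TMHole M [state q, tape a]

theorem HeadRule.exists_step {M : TM0.Machine Γ Q} {u v : List Γ} {q : Q} {a : Γ}
    {U l r : List (TMLetter Γ Q)} (hv : v ≠ []) (h : HeadRule M l r)
    (hU : u.reverse.map tape ++ [state q, tape a] = U ++ l) :
    ∃ u' q' a' v', TM0.step M (tmCfg u q a v) = some (tmCfg u' q' a' v') ∧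
      tmWord u' q' a' v' = U ++ r ++ v.map tape := by
  obtain ⟨b, v, rfl⟩ := List.exists_cons_of_ne_nil hv
  cases h with
  | @write q₀ a₀ q' b' h =>
    obtain ⟨rfl, h2⟩ := List.append_inj' hU rfl
    simp only [List.cons.injEq, state.injEq, tape.injEq, and_true] at h2
    obtain ⟨rfl, rfl⟩ := h2
    exact ⟨u, q', b', b :: v, by simp [TM0.step, tmCfg, h, Tape.write], by simp [tmWord]⟩
  | @right q₀ a₀ q' h =>
    obtain ⟨rfl, h2⟩ := List.append_inj' hU rfl
    simp only [List.cons.injEq, state.injEq, tape.injEq, and_true] at h2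
    obtain ⟨rfl, rfl⟩ := h2
    exact ⟨a :: u, q', b, v, by simp [TM0.step, tmCfg, h, Tape.move], by simp [tmWord]⟩
  | @left q₀ a₀ q' c h =>
    rw [show U ++ [tape c, state q₀, tape a₀] = (U ++ [tape c]) ++ [state q₀, tape a₀] by simp]
      at hU
    obtain ⟨h1, h2⟩ := List.append_inj' hU rfl
    simp only [List.cons.injEq, state.injEq, tape.injEq, and_true] at h2
    obtain ⟨rfl, rfl⟩ := h2
    cases u with
    | nil => simp at h1
    | cons c' u =>
      simp only [List.reverse_cons, List.map_append, List.map_cons, List.map_nil] at h1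
      obtain ⟨rfl, h2⟩ := List.append_inj' h1 rfl
      simp only [List.cons.injEq, tape.injEq, and_true] at h2
      subst h2
      exact ⟨u, q', c', a :: b :: v, by simp [TM0.step, tmCfg, h, Tape.move], by simp [tmWord]⟩

theorem TMRule.copy_of_mem (M : TM0.Machine Γ Q) (u : List Γ) :
    ∀ a ∈ u.map tape, TMRule M [a] [a] := by
  simp only [List.mem_map, forall_exists_index, and_imp, forall_apply_eq_imp_iff₂]
  exact fun a _ => .copy a

theorem wordMatch_of_halts {M : TM0.Machine Γ Q} {c c' : TM0.Cfg Γ Q}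
    (h : StateTransition.Reaches (TM0.step M) c c') (hc' : TM0.step M c' = none)
    {u v : List Γ} {q : Q} {a : Γ} (hu : u ≠ []) (hv : v ≠ []) (hc : tmCfg u q a v = c) :
    WordMatch (TMRule M) (TMHole M) (tmWord u q a v ++ [sep, tape default]) := by
  induction h using Relation.ReflTransGen.head_induction_on generalizing u q a v with
  | refl =>
    subst hc
    have h : M q a = none := by simpa [TM0.step, tmCfg] using hc'
    have hg := WordGen.copy_append (TMRule.copy_of_mem M u.reverse) .nil
    refine ⟨_, _, _, hg, .halt h, ?_⟩
    simp only [tmWord, List.append_nil, List.append_assoc, List.cons_append]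
    simp [List.prefix_append_right_inj]
  | head h _ ih =>
    subst hc
    have hn : M q a ≠ none := by
      rintro hn
      simp [TM0.step, tmCfg, hn] at h
    obtain ⟨U, l, r, hr, hU⟩ := HeadRule.exists_of_ne_none hu hn
    obtain ⟨u', q', a', v', hs, hw⟩ := hr.exists_step hv hU
    rw [Option.mem_def, hs, Option.some_inj] at h
    obtain ⟨w, z, l', hg, hl', hp⟩ := ih (u := u' ++ [default]) (v := v' ++ [default]) (by simp)
      (by simp) (by rw [tmCfg_eq_append, h])
    refine ⟨_, _, l', .copy_append (TMRule.copy_of_mem M U) (.cons (.head hr)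
      (.copy_append (TMRule.copy_of_mem M v) (.cons .sep hg))), hl', ?_⟩
    rw [tmWord_eq_cons, hw] at hp
    have h3 : tmWord u q a v = U.map tape ++ l ++ v.map tape := by
      rw [← hU]; simp [tmWord]
    rw [h3]
    simpa [List.prefix_append_right_inj] using hp

theorem halts_of_eq_none {M : TM0.Machine Γ Q} {u v : List Γ} {q : Q} {a : Γ}
    (h : M q a = none) : (StateTransition.eval (TM0.step M) (tmCfg u q a v)).Dom := by
  refine Part.dom_iff_mem.2 ⟨_, StateTransition.mem_eval.2 ⟨.refl, ?_⟩⟩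
  simp [TM0.step, tmCfg, h]

theorem halts_of_step {M : TM0.Machine Γ Q} {c c' : TM0.Cfg Γ Q} (h : TM0.step M c = some c')
    (hc' : (StateTransition.eval (TM0.step M) c').Dom) :
    (StateTransition.eval (TM0.step M) c).Dom := by
  rwa [StateTransition.reaches_eval (Relation.ReflTransGen.single h)]

theorem WordGen.exists_headRule {M : TM0.Machine Γ Q} {w z l : List (TMLetter Γ Q)}
    (hg : WordGen (TMRule M) w z) (hl : TMHole M l) {U : List Γ} {q : Q} {a : Γ}
    {s : List (TMLetter Γ Q)} (hp : w ++ l <+: U.map tape ++ state q :: tape a :: s) :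
    M q a = none ∨ ∃ U' l' r' w' z', HeadRule M l' r' ∧
      U.map tape ++ [state q, tape a] = U' ++ l' ∧ w = U' ++ l' ++ w' ∧ z = U' ++ r' ++ z' ∧
      WordGen (TMRule M) w' z' := by
  induction U generalizing w z with
  | nil =>
    cases hg with
    | nil =>
      obtain ⟨h⟩ := hl
      simp at hp
      obtain ⟨rfl, rfl⟩ := hp
      exact .inl h
    | cons hr hg =>
      right
      rcases hr with _ | _ | hr
      · simp at hp
      · simp at hp
      · refine ⟨[], _, _, _, _, hr, ?_, rfl, rfl, hg⟩
        cases hr <;> simp at hp ⊢ <;> tauto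
  | cons b U ih =>
    cases hg with
    | nil =>
      obtain ⟨h⟩ := hl
      simp at hp
    | cons hr hg =>
      rcases hr with c | _ | hr
      · simp at hp
        obtain ⟨rfl, hp⟩ := hp
        rcases ih hg hp with h | ⟨U', l', r', w', z', h1, h2, h3, h4, h5⟩
        · exact .inl h
        · exact .inr ⟨tape c :: U', l', r', w', z', h1, by simpa using h2, by simp [h3],
            by simp [h4], h5⟩
      · simp at hp
      · right
        refine ⟨[], _, _, _, _, hr, ?_, rfl, rfl, hg⟩
        cases hr with
        | write => simp at hp
        | right => simp at hp
        | left c h =>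
          cases U <;> simp at hp ⊢
          tauto

theorem WordGen.exists_sep {M : TM0.Machine Γ Q} {w z l : List (TMLetter Γ Q)}
    (hg : WordGen (TMRule M) w z) (hl : TMHole M l) {V : List Γ}
    {s : List (TMLetter Γ Q)} (hp : w ++ l <+: V.map tape ++ sep :: s) :
    ∃ w' z', w = V.map tape ++ sep :: w' ∧
      z = V.map tape ++ [tape default, sep, tape default] ++ z' ∧
      WordGen (TMRule M) w' z' := by
  induction V generalizing w z with
  | nil =>
    cases hg with
    | nil =>
      obtain ⟨h⟩ := hl
      simp at hp
    | cons hr hg =>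
      rcases hr with _ | _ | hr
      · simp at hp
      · exact ⟨_, _, rfl, rfl, hg⟩
      · cases hr <;> simp at hp
  | cons b V ih =>
    cases hg with
    | nil =>
      obtain ⟨h⟩ := hl
      simp at hp
    | cons hr hg =>
      rcases hr with c | _ | hr
      · simp at hp
        obtain ⟨rfl, hp⟩ := hp
        obtain ⟨w', z', h1, h2, h3⟩ := ih hg hp
        exact ⟨w', z', by simp [h1], by simp [h2], h3⟩
      · simp at hp
      · cases hr with
        | write => simp at hp
        | right => simp at hp
        | left c h => cases V <;> simp at hp

theorem halts_of_wordGen {M : TM0.Machine Γ Q} (n : ℕ) {w z l : List (TMLetter Γ Q)}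
    (hn : w.length ≤ n) (hg : WordGen (TMRule M) w z) (hl : TMHole M l) {u v : List Γ} {q : Q}
    {a : Γ} (hv : v ≠ [])
    (hp : w ++ l <+: tmWord u q a v ++ [sep, tape default] ++ z) :
    (StateTransition.eval (TM0.step M) (tmCfg u q a v)).Dom := by
  induction n generalizing w z u v q a with
  | zero =>
    have h := hg.exists_headRule hl (U := u.reverse) (q := q) (a := a)
      (s := v.map tape ++ [sep, tape default] ++ z) (by simpa [tmWord] using hp)
    rcases h with h | ⟨U', l', r', w', z', hr, hU, rfl, rfl, hg'⟩
    · exact halts_of_eq_none h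
    · cases hr <;> simp at hn
  | succ n ih =>
    have h := hg.exists_headRule hl (U := u.reverse) (q := q) (a := a)
      (s := v.map tape ++ [sep, tape default] ++ z) (by simpa [tmWord] using hp)
    rcases h with h | ⟨U', l', r', w', z', hr, hU, rfl, rfl, hg'⟩
    · exact halts_of_eq_none h
    obtain ⟨u', q', a', v', hs, hw⟩ := hr.exists_step hv hU
    have h3 : tmWord u q a v = U' ++ l' ++ v.map tape := by
      rw [← hU]; simp [tmWord]
    rw [h3] at hp
    simp only [List.append_assoc, List.prefix_append_right_inj] at hp
    obtain ⟨w'', z'', rfl, rfl, hg''⟩ := hg'.exists_sep hl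
      (s := tape default :: (U' ++ (r' ++ z'))) (by simpa using hp)
    refine halts_of_step hs ?_
    rw [← tmCfg_eq_append]
    refine ih (w := w'') (z := z'') ?_ hg'' (by simp) ?_
    · simp at hn; omega
    · rw [tmWord_eq_cons, hw]
      simpa [List.prefix_append_right_inj] using hp

theorem wordMatch_iff_halts {M : TM0.Machine Γ Q} {u v : List Γ} {q : Q} {a : Γ}
    (hu : u ≠ []) (hv : v ≠ []) :
    WordMatch (TMRule M) (TMHole M) (tmWord u q a v ++ [sep, tape default]) ↔
      (StateTransition.eval (TM0.step M) (tmCfg u q a v)).Dom := by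
  refine ⟨fun ⟨w, z, l, hg, hl, hp⟩ => halts_of_wordGen _ le_rfl hg hl hv hp, fun h => ?_⟩
  obtain ⟨h1, h2⟩ := StateTransition.mem_eval.1 (Part.get_mem h)
  exact wordMatch_of_halts h1 h2 hu hv rfl

theorem wordMatch_init_iff (M : TM0.Machine Γ Q) (a : Γ) (v : List Γ) :
    WordMatch (TMRule M) (TMHole M)
      (tmWord [default] default a (v ++ [default]) ++ [sep, tape default]) ↔
      (TM0.eval M (a :: v)).Dom := by
  rw [wordMatch_iff_halts (by simp) (by simp)]
  change (StateTransition.eval _ (tmCfg ([] ++ [default]) _ _ _)).Dom ↔ _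
  rw [tmCfg_eq_append]
  rfl

/-- The conditions on rules and holes under which a point of the square can be covered in at
most one way by the tiles given by the rules. -/
structure IsHoledCode {A : Type*} (R : List A → List A → Prop) (H : List A → Prop) (m : A) :
    Prop where
  left_ne_nil {l r} : R l r → l ≠ []
  right_ne_nil {l r} : R l r → r ≠ []
  left_length_le {l r} : R l r → l.length ≤ 3
  right_length_le {l r} : R l r → r.length ≤ 3
  notMem_left {l r} : R l r → m ∉ l
  notMem_right {l r} : R l r → m ∉ r
  hole_ne_nil {l} : H l → l ≠ []
  hole_length_le {l} : H l → l.length ≤ 3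
  notMem_hole {l} : H l → m ∉ l
  unique {l r l' r'} : R l r → R l' r' → PrefixComparable l l' → PrefixComparable r r' →
    l = l' ∧ r = r'

theorem isHoledCode_tmRule (M : TM0.Machine Γ Q) : IsHoledCode (TMRule M) (TMHole M) mark where
  left_ne_nil h := by rcases h with _ | _ | _ | _ | _ <;> simp
  right_ne_nil h := by rcases h with _ | _ | _ | _ | _ <;> simp
  left_length_le h := by rcases h with _ | _ | _ | _ | _ <;> simp
  right_length_le h := by rcases h with _ | _ | _ | _ | _ <;> simp
  notMem_left h := by rcases h with _ | _ | _ | _ | _ <;> simp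
  notMem_right h := by rcases h with _ | _ | _ | _ | _ <;> simp
  hole_ne_nil h := by cases h; simp
  hole_length_le h := by cases h; simp
  notMem_hole h := by cases h; simp
  unique h h' hl hr := by
    rcases h with _ | _ | h | h | h <;> rcases h' with _ | _ | h' | h' | h' <;>
      simp [PrefixComparable] at hl hr ⊢ <;> grind

end Correspondence

/-! ### Attractors of graph-directed iterated function systems -/

section Attractor

open Metric

/-- The union of the images of a family of sets under the maps of a system. -/
def gifsImage (L : List GifsEdge) (W : Fin 3 → Set (EuclideanSpace ℝ (Fin 2))) (q : Fin 3) :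
    Set (EuclideanSpace ℝ (Fin 2)) :=
  ⋃ e ∈ L, ⋃ (_ : e.1 = q), gifsEdgeMap e.2.2.1 e.2.2.2 '' W e.2.1

theorem mem_gifsImage {L : List GifsEdge} {W : Fin 3 → Set (EuclideanSpace ℝ (Fin 2))}
    {q : Fin 3} {x : EuclideanSpace ℝ (Fin 2)} :
    x ∈ gifsImage L W q ↔
      ∃ e ∈ L, e.1 = q ∧ ∃ y ∈ W e.2.1, gifsEdgeMap e.2.2.1 e.2.2.2 y = x := by
  simp only [gifsImage, Set.mem_iUnion, Set.mem_image, exists_prop]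

theorem gifsImage_mono (L : List GifsEdge) : Monotone (gifsImage L) := by
  intro W W' h q x hx
  obtain ⟨e, he, hq, y, hy, rfl⟩ := mem_gifsImage.1 hx
  exact mem_gifsImage.2 ⟨e, he, hq, y, h _ hy, rfl⟩

theorem exists_uniform_contraction {L : List GifsEdge}
    (hL : ∀ e ∈ L, IsContractingMap (gifsEdgeMap e.2.2.1 e.2.2.2)) :
    ∃ c : NNReal, c < 1 ∧ ∀ e ∈ L, LipschitzWith c (gifsEdgeMap e.2.2.1 e.2.2.2) := by
  induction L with
  | nil => exact ⟨0, by simp, by simp⟩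
  | cons e L ih =>
    obtain ⟨c, hc, h⟩ := ih fun e he => hL e (by simp [he])
    obtain ⟨d, hd, h'⟩ := hL e (by simp)
    refine ⟨max c d, max_lt hc hd, fun e' he => ?_⟩
    rcases List.mem_cons.1 he with rfl | he
    · exact h'.weaken (le_max_right _ _)
    · exact (h e' he).weaken (le_max_left _ _)

/-- A bounded family contained in its image is contained in every closed nonempty family that
contains its image. -/
theorem subset_of_subset_gifsImage {L : List GifsEdge}
    (hL : ∀ e ∈ L, IsContractingMap (gifsEdgeMap e.2.2.1 e.2.2.2))
    {W S : Fin 3 → Set (EuclideanSpace ℝ (Fin 2))} (hW : W ≤ gifsImage L W)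
    (hb : ∀ q, Bornology.IsBounded (W q)) (hS : gifsImage L S ≤ S)
    (hc : ∀ q, IsClosed (S q)) (hn : ∀ q, (S q).Nonempty) : W ≤ S := by
  obtain ⟨c, hc1, hlip⟩ := exists_uniform_contraction hL
  have hD : ∃ D : ℝ, ∀ q, ∀ w ∈ W q, infDist w (S q) ≤ D := by
    have h : ∀ q, ∃ D : ℝ, ∀ w ∈ W q, infDist w (S q) ≤ D := by
      intro q
      obtain ⟨x, hx⟩ := hn q
      obtain ⟨D, hD⟩ := (hb q).subset_closedBall x
      exact ⟨D, fun w hw => (infDist_le_dist_of_mem hx).trans (mem_closedBall.1 (hD hw))⟩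
    choose D hD using h
    exact ⟨max (D 0) (max (D 1) (D 2)), fun q w hw => (hD q w hw).trans (by fin_cases q <;> simp)⟩
  obtain ⟨D, hD⟩ := hD
  have key : ∀ n : ℕ, ∀ q, ∀ w ∈ W q, infDist w (S q) ≤ c ^ n * D := by
    intro n
    induction n with
    | zero => simpa using hD
    | succ n ih =>
      intro q w hw
      obtain ⟨e, he, rfl, y, hy, rfl⟩ := mem_gifsImage.1 (hW q hw)
      refine le_of_forall_pos_lt_add fun ε hε => ?_
      obtain ⟨s, hs, hys⟩ := (infDist_lt_iff (hn e.2.1)).1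
        (lt_of_le_of_lt (ih _ y hy) (lt_add_of_pos_right _ hε))
      calc infDist _ (S e.1)
          ≤ dist (gifsEdgeMap e.2.2.1 e.2.2.2 y) (gifsEdgeMap e.2.2.1 e.2.2.2 s) :=
            infDist_le_dist_of_mem (hS _ (mem_gifsImage.2 ⟨e, he, rfl, s, hs, rfl⟩))
        _ ≤ c * dist y s := (hlip e he).dist_le_mul _ _
        _ ≤ c * (c ^ n * D + ε) := by gcongr
        _ = c ^ (n + 1) * D + c * ε := by ring
        _ < c ^ (n + 1) * D + ε := by
          have : (c : ℝ) < 1 := hc1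
          nlinarith
  intro q w hw
  have ht : Filter.Tendsto (fun n : ℕ => (c : ℝ) ^ n * D) Filter.atTop (nhds (0 * D)) :=
    (tendsto_pow_atTop_nhds_zero_of_lt_one c.2 hc1).mul_const D
  rw [zero_mul] at ht
  have h0 : infDist w (S q) ≤ 0 := ge_of_tendsto' ht fun n => key n q w hw
  rw [← (hc q).closure_eq, mem_closure_iff_infDist_zero (hn q)]
  exact le_antisymm h0 infDist_nonneg

theorem isCompact_gifsImage {L : List GifsEdge}
    (hL : ∀ e ∈ L, IsContractingMap (gifsEdgeMap e.2.2.1 e.2.2.2))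
    {W : Fin 3 → Set (EuclideanSpace ℝ (Fin 2))} (hW : ∀ q, IsCompact (W q)) (q : Fin 3) :
    IsCompact (gifsImage L W q) := by
  refine (List.finite_toSet L).isCompact_biUnion fun e he => ?_
  by_cases h : e.1 = q
  · obtain ⟨c, -, hc⟩ := hL e he
    simpa [h] using (hW e.2.1).image hc.continuous
  · simp [h]

/-- A well-formed system that maps a family of nonempty compact sets into itself has
attractors. -/
theorem exists_isGifsAttractor {L : List GifsEdge} (hL : GifsWF L)
    {S : Fin 3 → Set (EuclideanSpace ℝ (Fin 2))} (hS : gifsImage L S ≤ S)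
    (hc : ∀ q, IsCompact (S q)) (hn : ∀ q, (S q).Nonempty) :
    ∃ X, IsGifsAttractor L X := by
  let F : (Fin 3 → Set (EuclideanSpace ℝ (Fin 2))) →o (Fin 3 → Set (EuclideanSpace ℝ (Fin 2))) :=
    ⟨fun W => gifsImage L W ⊓ S, fun W W' h => inf_le_inf_right _ (gifsImage_mono L h)⟩
  let X := F.gfp
  have hX : gifsImage L X ⊓ S = X := F.map_gfp
  have hXS : X ≤ S := by rw [← hX]; exact inf_le_right
  have hX' : gifsImage L X = X :=
    le_antisymm ((le_inf le_rfl ((gifsImage_mono L hXS).trans hS)).trans hX.le)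
      (hX.ge.trans inf_le_left)
  have hcl : (fun q => closure (X q)) ≤ X := by
    refine F.le_gfp (le_inf (fun q => ?_) fun q => closure_minimal (hXS q) (hc q).isClosed)
    have hcc : ∀ q, IsCompact (closure (X q)) := fun q =>
      (hc q).of_isClosed_subset isClosed_closure (closure_minimal (hXS q) (hc q).isClosed)
    refine closure_minimal ?_ (isCompact_gifsImage hL.1 hcc q).isClosed
    have := gifsImage_mono L (fun q => subset_closure : X ≤ fun q => closure (X q))
    rw [hX'] at this
    exact this q
  have hne : ∀ q, (X q).Nonempty := by
    obtain ⟨c, hc1, hlip⟩ := exists_uniform_contraction hL.1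
    choose e he heq using hL.2
    let G : (Fin 3 → EuclideanSpace ℝ (Fin 2)) → Fin 3 → EuclideanSpace ℝ (Fin 2) :=
      fun x q => gifsEdgeMap (e q).2.2.1 (e q).2.2.2 (x (e q).2.1)
    have hG : ContractingWith c G := by
      refine ⟨hc1, LipschitzWith.of_dist_le_mul fun x y => ?_⟩
      refine (dist_pi_le_iff (by positivity)).2 fun q => ?_
      exact ((hlip _ (he q)).dist_le_mul _ _).trans
        (mul_le_mul_of_nonneg_left (dist_le_pi_dist x y _) c.2)
    let x := hG.fixedPoint
    have hx : G x = x := hG.fixedPoint_isFixedPt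
    let W : Fin 3 → Set (EuclideanSpace ℝ (Fin 2)) := fun q => {x q}
    have hW : W ≤ gifsImage L W := by
      rintro q _ rfl
      refine mem_gifsImage.2 ⟨e q, he q, heq q, _, rfl, ?_⟩
      exact congrFun hx q
    have hWS : W ≤ S := subset_of_subset_gifsImage hL.1 hW
      (fun q => Bornology.isBounded_singleton) hS (fun q => (hc q).isClosed) hn
    have hWX : W ≤ X := F.le_gfp (le_inf hW hWS)
    exact fun q => ⟨x q, hWX q rfl⟩
  refine ⟨X, fun q => ⟨hne q, ?_⟩, fun q => (congrFun hX' q).symm⟩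
  exact (hc q).of_isClosed_subset (closure_eq_iff_isClosed.1
    (Set.Subset.antisymm (hcl q) subset_closure)) (hXS q)

/-- The edge with the map `(x, y) ↦ (a x + s, b y + t)`. -/
def diagEdge (i j : Fin 3) (a s b t : ℚ) : GifsEdge := (i, j, ![![a, 0], ![0, b]], ![s, t])

theorem gifsEdgeMap_diag (a s b t : ℚ) (p : EuclideanSpace ℝ (Fin 2)) :
    gifsEdgeMap ![![a, 0], ![0, b]] ![s, t] p = !₂[a * p 0 + s, b * p 1 + t] := by
  ext i
  fin_cases i <;> simp [gifsEdgeMap, Fin.sum_univ_two]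

theorem isContractingMap_diag {a s b t : ℚ} (ha : 0 ≤ a) (ha' : a < 1) (hb : 0 ≤ b)
    (hb' : b < 1) : IsContractingMap (gifsEdgeMap ![![a, 0], ![0, b]] ![s, t]) := by
  have hm : (0 : ℝ) ≤ max (a : ℝ) b := le_max_of_le_left (by exact_mod_cast ha)
  refine ⟨⟨max (a : ℝ) b, hm⟩, ?_, LipschitzWith.of_dist_le_mul fun p p' => ?_⟩
  · have : max (a : ℝ) b < 1 := max_lt (by exact_mod_cast ha') (by exact_mod_cast hb')
    exact this
  · rw [gifsEdgeMap_diag, gifsEdgeMap_diag, EuclideanSpace.dist_eq, EuclideanSpace.dist_eq]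
    change _ ≤ max (a : ℝ) b * _
    refine Real.sqrt_le_iff.2 ⟨by positivity, ?_⟩
    rw [mul_pow, Real.sq_sqrt (by positivity)]
    simp only [Fin.sum_univ_two, Real.dist_eq, sq_abs, mul_add]
    have key : ∀ r u v w : ℝ, 0 ≤ r → r ≤ max (a : ℝ) b →
        (r * u + w - (r * v + w)) ^ 2 ≤ max (a : ℝ) b ^ 2 * (u - v) ^ 2 := by
      intro r u v w h0 h1
      rw [show r * u + w - (r * v + w) = r * (u - v) by ring, mul_pow]
      gcongr
    exact add_le_add (key _ _ _ _ (by exact_mod_cast ha) (le_max_left _ _))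
      (key _ _ _ _ (by exact_mod_cast hb) (le_max_right _ _))

theorem isCompact_unitSquare : IsCompact UnitSquare := by
  have h : UnitSquare = (PiLp.homeomorph 2 fun _ : Fin 2 => ℝ) ⁻¹'
      (Set.univ.pi fun _ => Set.Icc 0 1) := by
    ext x
    simp only [Set.mem_preimage, Set.mem_pi, Set.mem_univ, true_implies]
    rfl
  rw [h, Homeomorph.isCompact_preimage]
  exact isCompact_univ_pi fun _ => isCompact_Icc

end Attractor

/-! ### Base expansions of irrational numbers -/

section Expansion

open Set

/-- The irrational numbers of the unit interval. -/
def IrrUnit : Set ℝ := {x | Irrational x ∧ x ∈ Icc (0 : ℝ) 1}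

theorem IrrUnit.pos {x : ℝ} (h : x ∈ IrrUnit) : 0 < x :=
  lt_of_le_of_ne h.2.1 fun h0 => h.1 ⟨0, by simpa using h0⟩

theorem IrrUnit.lt_one {x : ℝ} (h : x ∈ IrrUnit) : x < 1 :=
  lt_of_le_of_ne h.2.2 fun h1 => h.1 ⟨1, by simpa using h1.symm⟩

theorem irrUnit_nonempty : IrrUnit.Nonempty := by
  obtain ⟨x, hx, h0, h1⟩ := exists_irrational_btwn (zero_lt_one (α := ℝ))
  exact ⟨x, hx, h0.le, h1.le⟩

theorem Irrational.of_eq_rat_mul_add {a s : ℚ} {x y : ℝ} (hx : Irrational x)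
    (h : x = a * y + s) : Irrational y := by
  rintro ⟨q, rfl⟩
  exact hx ⟨a * q + s, by rw [h]; push_cast; ring⟩

variable {A : Type*} {B : ℕ} (dig : A ≃ Fin B)

/-- The map `x ↦ 0.ux` that prepends the word `u` to a base `B` expansion. -/
noncomputable def wordMap : List A → ℝ → ℝ
  | [], x => x
  | a :: u, x => ((dig a : ℕ) + wordMap u x) / B

/-- The number with base `B` expansion `u`. -/
def wordNat (u : List A) : ℕ := u.foldl (fun n a => n * B + dig a) 0

theorem wordMap_append (u v : List A) (x : ℝ) :
    wordMap dig (u ++ v) x = wordMap dig u (wordMap dig v x) := by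
  induction u with
  | nil => rfl
  | cons a u ih => simp [wordMap, ih]

theorem wordNat_foldl (n : ℕ) (u : List A) :
    u.foldl (fun n a => n * B + dig a) n = n * B ^ u.length + wordNat dig u := by
  induction u generalizing n with
  | nil => simp [wordNat]
  | cons a u ih =>
    rw [wordNat, List.foldl_cons, List.foldl_cons, ih, ih]
    simp [pow_succ]; ring

theorem wordNat_cons (a : A) (u : List A) :
    wordNat dig (a :: u) = dig a * B ^ u.length + wordNat dig u := by
  rw [wordNat, List.foldl_cons, wordNat_foldl]
  simp

theorem base_pos_of_letter {A : Type*} {B : ℕ} (dig : A ≃ Fin B) (a : A) : 0 < B :=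
  (Nat.zero_le _).trans_lt (dig a).2

theorem wordMap_eq (u : List A) (x : ℝ) :
    wordMap dig u x = (wordNat dig u + x) / B ^ u.length := by
  induction u with
  | nil => simp [wordMap, wordNat]
  | cons a u ih =>
    have hB : (B : ℝ) ≠ 0 := by exact_mod_cast (base_pos_of_letter dig a).ne'
    rw [wordMap, ih, wordNat_cons, List.length_cons]
    push_cast
    field_simp
    ring

theorem wordMap_strictMono (u : List A) : StrictMono (wordMap dig u) := by
  induction u with
  | nil => exact strictMono_id
  | cons a u ih =>
    intro x y h
    have hB : (0 : ℝ) < B := by exact_mod_cast base_pos_of_letter dig a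
    have := ih h
    simp only [wordMap]
    gcongr

theorem wordMap_mem_Icc (u : List A) {x : ℝ} (hx : x ∈ Icc (0 : ℝ) 1) :
    wordMap dig u x ∈ Icc (0 : ℝ) 1 := by
  induction u with
  | nil => exact hx
  | cons a u ih =>
    have hB : (0 : ℝ) < B := by exact_mod_cast base_pos_of_letter dig a
    have hd : ((dig a : ℕ) : ℝ) + 1 ≤ B := by exact_mod_cast (dig a).2
    have h0 : (0 : ℝ) ≤ (dig a : ℕ) := Nat.cast_nonneg _
    rw [wordMap]
    refine ⟨div_nonneg (add_nonneg h0 ih.1) hB.le, (div_le_one hB).2 ?_⟩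
    linarith [ih.2]

theorem wordMap_eq_rat (u : List A) (x : ℝ) :
    wordMap dig u x = ((1 / B ^ u.length : ℚ) : ℝ) * x +
      ((wordNat dig u / B ^ u.length : ℚ) : ℝ) := by
  rw [wordMap_eq]
  push_cast
  ring

theorem irrational_of_wordMap {u : List A} {x : ℝ} (h : Irrational (wordMap dig u x)) :
    Irrational x :=
  h.of_eq_rat_mul_add (wordMap_eq_rat dig u x)

theorem mem_irrUnit_of_wordMap {u : List A} {x : ℝ} (hx : x ∈ Icc (0 : ℝ) 1)
    (h : wordMap dig u x ∈ IrrUnit) : x ∈ IrrUnit :=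
  ⟨irrational_of_wordMap dig h.1, hx⟩

theorem wordMap_mem_irrUnit (u : List A) {x : ℝ} (hx : x ∈ IrrUnit) :
    wordMap dig u x ∈ IrrUnit := by
  refine ⟨?_, wordMap_mem_Icc dig u hx.2⟩
  cases u with
  | nil => exact hx.1
  | cons a u =>
    have hB : (B : ℝ) ≠ 0 := by exact_mod_cast (base_pos_of_letter dig a).ne'
    refine hx.1.of_eq_rat_mul_add (a := B ^ (a :: u).length) (s := - wordNat dig (a :: u)) ?_
    rw [wordMap_eq]
    push_cast
    field_simp
    ring

theorem exists_wordMap_singleton (hB : 0 < B) {x : ℝ} (hx : x ∈ IrrUnit) :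
    ∃ a, ∃ t ∈ IrrUnit, x = wordMap dig [a] t := by
  have hB' : (0 : ℝ) < B := by exact_mod_cast hB
  have hfl : ⌊x * B⌋₊ < B :=
    (Nat.floor_lt (by have := IrrUnit.pos hx; positivity)).2 (by nlinarith [IrrUnit.lt_one hx])
  have heq : x = wordMap dig [dig.symm ⟨_, hfl⟩] (x * B - ⌊x * B⌋₊) := by
    simp [wordMap]
    field_simp
  refine ⟨_, _, mem_irrUnit_of_wordMap dig ⟨?_, ?_⟩ (heq ▸ hx), heq⟩
  · exact sub_nonneg.2 (Nat.floor_le (by have := IrrUnit.pos hx; positivity))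
  · linarith [Nat.lt_floor_add_one (x * B)]

theorem exists_wordMap_length (hB : 0 < B) (n : ℕ) {x : ℝ} (hx : x ∈ IrrUnit) :
    ∃ u : List A, u.length = n ∧ ∃ t ∈ IrrUnit, x = wordMap dig u t := by
  induction n generalizing x with
  | zero => exact ⟨[], rfl, x, hx, rfl⟩
  | succ n ih =>
    obtain ⟨a, t, ht, rfl⟩ := exists_wordMap_singleton dig hB hx
    obtain ⟨u, hu, t', ht', rfl⟩ := ih ht
    exact ⟨a :: u, by simp [hu], t', ht', rfl⟩

theorem prefixComparable_of_wordMap_eq {u v : List A} {x y : ℝ} (hx : x ∈ IrrUnit)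
    (hy : y ∈ IrrUnit) (h : wordMap dig u x = wordMap dig v y) : PrefixComparable u v := by
  induction u generalizing v with
  | nil => exact .inl (List.nil_prefix)
  | cons a u ih =>
    cases v with
    | nil => exact .inr (List.nil_prefix)
    | cons b v =>
      have hB : (0 : ℝ) < B := by exact_mod_cast base_pos_of_letter dig a
      have hu := wordMap_mem_irrUnit dig u hx
      have hv := wordMap_mem_irrUnit dig v hy
      rw [wordMap, wordMap, div_left_inj' hB.ne'] at h
      have h1 := IrrUnit.pos hu
      have h2 := IrrUnit.lt_one hu
      have h3 := IrrUnit.pos hv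
      have h4 := IrrUnit.lt_one hv
      have hab : ((dig a : ℕ) : ℤ) = (dig b : ℕ) := by
        apply le_antisymm <;> apply Int.lt_add_one_iff.1 <;> rify <;> linarith
      have hab' : a = b := dig.injective (Fin.ext (by exact_mod_cast hab))
      subst hab'
      rcases ih (v := v) (by linarith) with h | h
      · exact .inl (by simpa using h)
      · exact .inr (by simpa using h)

end Expansion

/-! ### The system associated with a correspondence problem -/

section System

open Set

theorem prefix_of_comparable_append {A : Type*} {m : A} {u v : List A} (hu : m ∉ u)
    (h : PrefixComparable u (v ++ [m])) : u <+: v := by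
  rcases h with h | h
  · rcases List.prefix_concat_iff.1 h with rfl | h
    · simp at hu
    · exact h
  · exact absurd (h.subset (by simp)) hu

theorem eq_of_comparable_append {A : Type*} {m : A} {u v : List A} (hu : m ∉ u) (hv : m ∉ v)
    (h : PrefixComparable (u ++ [m]) (v ++ [m])) : u = v := by
  have h1 : u <+: v := by
    refine prefix_of_comparable_append hu ?_
    rcases h with h | h
    · exact .inl ((List.prefix_append u [m]).trans h)
    · exact List.prefix_or_prefix_of_prefix (List.prefix_append u [m]) h
  have h2 : v <+: u := by
    refine prefix_of_comparable_append hv ?_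
    rcases h with h | h
    · exact List.prefix_or_prefix_of_prefix (List.prefix_append v [m]) h
    · exact .inl ((List.prefix_append v [m]).trans h)
  exact h1.eq_of_length_le h2.length_le

theorem IsHoledCode.notMem_wordGen_left {A : Type*} {R : List A → List A → Prop}
    {H : List A → Prop} {m : A} (hc : IsHoledCode R H m) {w z : List A} (h : WordGen R w z) :
    m ∉ w := by
  induction h with
  | nil => simp
  | cons hr _ ih => simp [hc.notMem_left hr, ih]

theorem IsHoledCode.notMem_wordGen_right {A : Type*} {R : List A → List A → Prop}
    {H : List A → Prop} {m : A} (hc : IsHoledCode R H m) {w z : List A} (h : WordGen R w z) :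
    m ∉ z := by
  induction h with
  | nil => simp
  | cons hr _ ih => simp [hc.notMem_right hr, ih]

variable {A : Type} {B : ℕ} (dig : A ≃ Fin B) (R : List A → List A → Prop) (H : List A → Prop)
  (m sep : A) (s : List A)

/-- The edge whose map prepends the words `u` and `v` to the expansions of the coordinates. -/
def wordEdge (i j : Fin 3) (u v : List A) : GifsEdge :=
  diagEdge i j ((1 : ℕ) / (B ^ u.length : ℕ)) (wordNat dig u / (B ^ u.length : ℕ))
    ((1 : ℕ) / (B ^ v.length : ℕ)) (wordNat dig v / (B ^ v.length : ℕ))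

/-- The edges that do not depend on the word `s`. -/
inductive EdgeWords : Fin 3 → Fin 3 → List A → List A → Prop
  | tile {a b} : a ≠ sep ∨ b ≠ sep → EdgeWords 0 0 [a] [b]
  | rules : EdgeWords 0 2 [sep] [sep]
  | diag {a} : a ≠ m → EdgeWords 1 1 [a] [a]
  | offDiag {a b} : a ≠ b → EdgeWords 1 0 [a] [b]
  | rule {l r} : R l r → EdgeWords 2 2 l r
  | rest {u v} : u.length = 3 → v.length = 3 → (∀ l r, R l r → ¬ (l <+: u ∧ r <+: v)) →
      (∀ l, H l → ¬ (l <+: u ∧ [m] <+: v)) → EdgeWords 2 0 u v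

/-- The edge onto the part to the left of the interval of the word `sep :: s`. -/
def leftEdge : GifsEdge :=
  diagEdge 0 0 (wordNat dig s / (B ^ (s.length + 1) : ℕ)) ((dig sep : ℕ) / (B : ℕ))
    ((1 : ℕ) / (B : ℕ)) ((dig sep : ℕ) / (B : ℕ))

/-- The edge onto the part to the right of the interval of the word `sep :: s`. -/
def rightEdge : GifsEdge :=
  diagEdge 0 0 ((B ^ s.length - (wordNat dig s + 1) : ℕ) / (B ^ (s.length + 1) : ℕ))
    ((wordNat dig (sep :: s) + 1 : ℕ) / (B ^ (s.length + 1) : ℕ))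
    ((1 : ℕ) / (B : ℕ)) ((dig sep : ℕ) / (B : ℕ))

variable {R H m}

theorem EdgeWords.left_ne_nil (hc : IsHoledCode R H m) {i j : Fin 3} {u v : List A}
    (h : EdgeWords R H m sep i j u v) : u ≠ [] := by
  rcases h with _ | _ | _ | _ | h | h <;> first | exact hc.left_ne_nil h | grind

theorem EdgeWords.right_ne_nil (hc : IsHoledCode R H m) {i j : Fin 3} {u v : List A}
    (h : EdgeWords R H m sep i j u v) : v ≠ [] := by
  rcases h with _ | _ | _ | _ | h | ⟨_, h⟩ <;> first | exact hc.right_ne_nil h | grind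

theorem EdgeWords.length_le (hc : IsHoledCode R H m) {i j : Fin 3} {u v : List A}
    (h : EdgeWords R H m sep i j u v) : u.length ≤ 3 ∧ v.length ≤ 3 := by
  rcases h with _ | _ | _ | _ | h | ⟨h, h'⟩ <;>
    first | exact ⟨hc.left_length_le h, hc.right_length_le h⟩ | exact ⟨h.le, h'.le⟩ | simp

theorem finite_setOf_edgeWords (hc : IsHoledCode R H m) :
    {e : GifsEdge | ∃ i j u v, EdgeWords R H m sep i j u v ∧ e = wordEdge dig i j u v}.Finite := by
  have : Finite A := Finite.of_equiv _ dig.symm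
  have h3 := List.finite_length_le A 3
  refine (((Set.finite_univ (α := Fin 3)).prod ((Set.finite_univ (α := Fin 3)).prod
    (h3.prod h3))).image fun x => wordEdge dig x.1 x.2.1 x.2.2.1 x.2.2.2).subset ?_
  rintro e ⟨i, j, u, v, h, rfl⟩
  exact ⟨(i, j, u, v), ⟨trivial, trivial, h.length_le sep hc⟩, rfl⟩

/-- The list of the edges that do not depend on `s`. -/
noncomputable def fixedEdges (hc : IsHoledCode R H m) : List GifsEdge :=
  (finite_setOf_edgeWords dig sep hc).toFinset.toList

/-- The system associated with the rules `R`, the holes `H` and the word `s`. -/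
noncomputable def matchGifs (hc : IsHoledCode R H m) : List GifsEdge :=
  wordEdge dig 0 1 (sep :: s) [sep] :: leftEdge dig sep s :: rightEdge dig sep s ::
    fixedEdges dig sep hc

theorem gifsEdgeMap_wordEdge (i j : Fin 3) (u v : List A) (p : EuclideanSpace ℝ (Fin 2)) :
    gifsEdgeMap (wordEdge dig i j u v).2.2.1 (wordEdge dig i j u v).2.2.2 p =
      !₂[wordMap dig u (p 0), wordMap dig v (p 1)] := by
  rw [wordMap_eq_rat, wordMap_eq_rat]
  simp only [wordEdge, diagEdge, gifsEdgeMap_diag]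
  push_cast
  rfl

/-- The first coordinate of the map of `leftEdge`. -/
noncomputable def leftMap (x : ℝ) : ℝ :=
  wordMap dig [sep] (wordNat dig s / B ^ s.length * x)

/-- The first coordinate of the map of `rightEdge`. -/
noncomputable def rightMap (x : ℝ) : ℝ :=
  wordMap dig [sep] (wordMap dig s 1 + (1 - wordMap dig s 1) * x)

theorem gifsEdgeMap_leftEdge (p : EuclideanSpace ℝ (Fin 2)) :
    gifsEdgeMap (leftEdge dig sep s).2.2.1 (leftEdge dig sep s).2.2.2 p =
      !₂[leftMap dig sep s (p 0), wordMap dig [sep] (p 1)] := by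
  have hB : (B : ℝ) ≠ 0 := by exact_mod_cast (base_pos_of_letter dig sep).ne'
  simp only [leftEdge, diagEdge, gifsEdgeMap_diag, leftMap, wordMap]
  push_cast
  congr 3 <;> field_simp <;> ring

theorem wordNat_lt (hB : 0 < B) : wordNat dig s < B ^ s.length := by
  have h := (wordMap_mem_Icc dig s (x := 1) (by simp)).2
  rw [wordMap_eq, div_le_one (by positivity)] at h
  exact_mod_cast h

theorem gifsEdgeMap_rightEdge (p : EuclideanSpace ℝ (Fin 2)) :
    gifsEdgeMap (rightEdge dig sep s).2.2.1 (rightEdge dig sep s).2.2.2 p =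
      !₂[rightMap dig sep s (p 0), wordMap dig [sep] (p 1)] := by
  have hB : (B : ℝ) ≠ 0 := by exact_mod_cast (base_pos_of_letter dig sep).ne'
  have hs := wordNat_lt dig s (base_pos_of_letter dig sep)
  simp only [rightEdge, diagEdge, gifsEdgeMap_diag, rightMap, wordMap, wordMap_eq,
    wordNat_cons dig sep s, Nat.cast_sub (Nat.succ_le_of_lt hs)]
  push_cast
  congr 3 <;> field_simp <;> ring

theorem mem_matchGifs (hc : IsHoledCode R H m) {e : GifsEdge} :
    e ∈ matchGifs dig sep s hc ↔
      (∃ i j u v, (EdgeWords R H m sep i j u v ∨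
        (i = 0 ∧ j = 1 ∧ u = sep :: s ∧ v = [sep])) ∧ e = wordEdge dig i j u v) ∨
      e = leftEdge dig sep s ∨ e = rightEdge dig sep s := by
  simp only [matchGifs, fixedEdges, List.mem_cons, Finset.mem_toList, Set.Finite.mem_toFinset,
    Set.mem_ofPred_eq]
  constructor
  · rintro (h | h | h | ⟨i, j, u, v, h, h'⟩)
    · exact .inl ⟨_, _, _, _, .inr ⟨rfl, rfl, rfl, rfl⟩, h⟩
    · exact .inr (.inl h)
    · exact .inr (.inr h)
    · exact .inl ⟨i, j, u, v, .inl h, h'⟩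
  · rintro (⟨i, j, u, v, h | ⟨rfl, rfl, rfl, rfl⟩, h'⟩ | h | h)
    · exact .inr (.inr (.inr ⟨i, j, u, v, h, h'⟩))
    · exact .inl h'
    · exact .inr (.inl h)
    · exact .inr (.inr (.inl h))

theorem mem_gifsImage_matchGifs (hc : IsHoledCode R H m)
    {X : Fin 3 → Set (EuclideanSpace ℝ (Fin 2))} {q : Fin 3} {p : EuclideanSpace ℝ (Fin 2)} :
    p ∈ gifsImage (matchGifs dig sep s hc) X q ↔
      (∃ j u v, (EdgeWords R H m sep q j u v ∨ (q = 0 ∧ j = 1 ∧ u = sep :: s ∧ v = [sep])) ∧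
        ∃ p' ∈ X j, p = !₂[wordMap dig u (p' 0), wordMap dig v (p' 1)]) ∨
      (q = 0 ∧ ∃ p' ∈ X 0, p = !₂[leftMap dig sep s (p' 0), wordMap dig [sep] (p' 1)] ∨
        p = !₂[rightMap dig sep s (p' 0), wordMap dig [sep] (p' 1)]) := by
  rw [mem_gifsImage]
  constructor
  · rintro ⟨e, he, rfl, p', hp', rfl⟩
    rcases (mem_matchGifs dig sep s hc).1 he with ⟨i, j, u, v, h, rfl⟩ | rfl | rfl
    · exact .inl ⟨j, u, v, h, p', hp', gifsEdgeMap_wordEdge dig i j u v p'⟩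
    · exact .inr ⟨rfl, p', hp', .inl (gifsEdgeMap_leftEdge dig sep s p')⟩
    · exact .inr ⟨rfl, p', hp', .inr (gifsEdgeMap_rightEdge dig sep s p')⟩
  · rintro (⟨j, u, v, h, p', hp', rfl⟩ | ⟨rfl, p', hp', rfl | rfl⟩)
    · exact ⟨_, (mem_matchGifs dig sep s hc).2 (.inl ⟨q, j, u, v, h, rfl⟩), rfl, p', hp',
        gifsEdgeMap_wordEdge dig q j u v p'⟩
    · exact ⟨_, (mem_matchGifs dig sep s hc).2 (.inr (.inl rfl)), rfl, p', hp',
        gifsEdgeMap_leftEdge dig sep s p'⟩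
    · exact ⟨_, (mem_matchGifs dig sep s hc).2 (.inr (.inr rfl)), rfl, p', hp',
        gifsEdgeMap_rightEdge dig sep s p'⟩

theorem leftMap_mem_Icc {x : ℝ} (hx : x ∈ Icc (0 : ℝ) 1) : leftMap dig sep s x ∈ Icc (0 : ℝ) 1 := by
  have h := wordMap_mem_Icc dig s (x := 0) (by simp)
  rw [wordMap_eq, add_zero] at h
  exact wordMap_mem_Icc dig _ ⟨mul_nonneg h.1 hx.1, mul_le_one₀ h.2 hx.1 hx.2⟩

theorem rightMap_mem_Icc {x : ℝ} (hx : x ∈ Icc (0 : ℝ) 1) :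
    rightMap dig sep s x ∈ Icc (0 : ℝ) 1 := by
  have h := wordMap_mem_Icc dig s (x := 1) (by simp)
  refine wordMap_mem_Icc dig _ ⟨?_, ?_⟩
  · exact add_nonneg h.1 (mul_nonneg (sub_nonneg.2 h.2) hx.1)
  · nlinarith [h.2, hx.2]

theorem gifsImage_unitSquare_le (hc : IsHoledCode R H m) :
    gifsImage (matchGifs dig sep s hc) (fun _ => UnitSquare) ≤ fun _ => UnitSquare := by
  intro q p hp
  rcases (mem_gifsImage_matchGifs dig sep s hc).1 hp with
    ⟨j, u, v, -, p', hp', rfl⟩ | ⟨rfl, p', hp', rfl | rfl⟩ <;>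
  · intro i
    fin_cases i
    · first
      | exact wordMap_mem_Icc dig _ (hp' 0)
      | exact leftMap_mem_Icc dig sep s (hp' 0)
      | exact rightMap_mem_Icc dig sep s (hp' 0)
    · exact wordMap_mem_Icc dig _ (hp' 1)

theorem one_lt_base {A : Type} {B : ℕ} (dig : A ≃ Fin B) {m sep : A} (hm : sep ≠ m) :
    1 < B := by
  by_contra h
  have h1 := (dig sep).2
  have h2 := (dig m).2
  exact hm (dig.injective (Fin.ext (by omega)))

theorem gifsWF_matchGifs (hc : IsHoledCode R H m) (hm : sep ≠ m) :
    GifsWF (matchGifs dig sep s hc) := by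
  have hB := one_lt_base dig hm
  have hscale : ∀ u : List A, u ≠ [] → (0 : ℚ) ≤ (1 : ℕ) / (B ^ u.length : ℕ) ∧
      ((1 : ℕ) / (B ^ u.length : ℕ) : ℚ) < 1 := by
    intro u hu
    have h := Nat.one_lt_pow (by simpa using hu) hB (n := u.length)
    refine ⟨by positivity, (div_lt_one (by positivity)).2 (by exact_mod_cast h)⟩
  have hside : ∀ n : ℕ, n < B ^ s.length → (0 : ℚ) ≤ n / (B ^ (s.length + 1) : ℕ) ∧
      (n / (B ^ (s.length + 1) : ℕ) : ℚ) < 1 := by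
    intro n hn
    have h : n < B ^ (s.length + 1) := hn.trans_le (Nat.pow_le_pow_right hB.le (by omega))
    refine ⟨by positivity, (div_lt_one (by positivity)).2 (by exact_mod_cast h)⟩
  have hone : (0 : ℚ) ≤ (1 : ℕ) / (B : ℕ) ∧ ((1 : ℕ) / (B : ℕ) : ℚ) < 1 := by
    simpa using hscale [sep] (by simp)
  have hs := wordNat_lt dig s hB.le
  refine ⟨fun e he => ?_, fun q => ?_⟩
  · rcases (mem_matchGifs dig sep s hc).1 he with ⟨i, j, u, v, h, rfl⟩ | rfl | rfl
    · have huv : u ≠ [] ∧ v ≠ [] := by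
        rcases h with h | ⟨-, -, rfl, rfl⟩
        · exact ⟨h.left_ne_nil sep hc, h.right_ne_nil sep hc⟩
        · simp
      exact isContractingMap_diag (hscale u huv.1).1 (hscale u huv.1).2 (hscale v huv.2).1
        (hscale v huv.2).2
    · exact isContractingMap_diag (hside _ hs).1 (hside _ hs).2 hone.1 hone.2
    · have := hside (B ^ s.length - (wordNat dig s + 1)) (by omega)
      exact isContractingMap_diag this.1 this.2 hone.1 hone.2
  · have h : ∃ j u v, EdgeWords R H m sep q j u v := by
      fin_cases q
      · exact ⟨_, _, _, .rules⟩
      · exact ⟨_, _, _, .diag hm⟩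
      · refine ⟨_, _, _, .rest (u := [m, m, m]) (v := [m, m, m]) rfl rfl ?_ ?_⟩
        · rintro l r h ⟨h1, -⟩
          have := hc.left_ne_nil h
          have := hc.notMem_left h
          cases l <;> simp at h1 <;> grind
        · rintro l h ⟨h1, -⟩
          have := hc.hole_ne_nil h
          have := hc.notMem_hole h
          cases l <;> simp at h1 <;> grind
    obtain ⟨j, u, v, h⟩ := h
    exact ⟨_, (mem_matchGifs dig sep s hc).2 (.inl ⟨q, j, u, v, .inl h, rfl⟩), rfl⟩

end System

/-! ### Attractors and matches -/

section Match

open Set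

variable {A : Type} {B : ℕ} (dig : A ≃ Fin B) (R : List A → List A → Prop) (H : List A → Prop)
  (m sep : A) (s : List A)

/-- The points missed at the vertex `1`. -/
def MissedDiag (x y : ℝ) : Prop :=
  ∃ z, m ∉ z ∧ ∃ t ∈ IrrUnit, ∃ t' ∈ IrrUnit,
    x = wordMap dig (z ++ [m]) t ∧ y = wordMap dig (z ++ [m]) t'

/-- The points missed at the vertex `2`. -/
def MissedRule (x y : ℝ) : Prop :=
  ∃ w z l, WordGen R w z ∧ H l ∧ ∃ t ∈ IrrUnit, ∃ t' ∈ IrrUnit,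
    x = wordMap dig (w ++ l) t ∧ y = wordMap dig (z ++ [m]) t'

/-- The irrational points that are not missed. -/
def keptPoints : Fin 3 → Set (EuclideanSpace ℝ (Fin 2)) := fun q =>
  {p | p 0 ∈ IrrUnit ∧ p 1 ∈ IrrUnit ∧ (q = 1 → ¬ MissedDiag dig m (p 0) (p 1)) ∧
    (q = 2 → ¬ MissedRule dig R H m (p 0) (p 1))}

variable {R H m}

theorem mem_keptPoints {q : Fin 3} {x y : ℝ} :
    !₂[x, y] ∈ keptPoints dig R H m q ↔ x ∈ IrrUnit ∧ y ∈ IrrUnit ∧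
      (q = 1 → ¬ MissedDiag dig m x y) ∧ (q = 2 → ¬ MissedRule dig R H m x y) := Iff.rfl

theorem eq_toLp (p : EuclideanSpace ℝ (Fin 2)) : p = !₂[p 0, p 1] := by
  ext i
  fin_cases i <;> rfl

theorem exists_leftMap {x : ℝ} (hx : x ∈ IrrUnit) (h : x ≤ wordMap dig s 0) :
    ∃ t ∈ IrrUnit, wordMap dig [sep] x = leftMap dig sep s t := by
  have h0 := IrrUnit.pos hx
  have heq : wordMap dig s 0 = wordNat dig s / B ^ s.length := by rw [wordMap_eq, add_zero]
  rw [heq] at h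
  have hpos : (0 : ℝ) < wordNat dig s / B ^ s.length := h0.trans_le h
  refine ⟨x / (wordNat dig s / B ^ s.length), ⟨?_, by positivity, (div_le_one hpos).2 h⟩, ?_⟩
  · refine hx.1.of_eq_rat_mul_add (a := wordNat dig s / B ^ s.length) (s := 0) ?_
    push_cast
    rw [mul_div_cancel₀ _ hpos.ne', add_zero]
  · rw [leftMap, mul_div_cancel₀ _ hpos.ne']

theorem exists_rightMap {x : ℝ} (hx : x ∈ IrrUnit) (h : wordMap dig s 1 ≤ x) :
    ∃ t ∈ IrrUnit, wordMap dig [sep] x = rightMap dig sep s t := by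
  have h1 := IrrUnit.lt_one hx
  have hpos : 0 < 1 - wordMap dig s 1 := by linarith
  refine ⟨(x - wordMap dig s 1) / (1 - wordMap dig s 1), ⟨?_, ?_, ?_⟩, ?_⟩
  · refine hx.1.of_eq_rat_mul_add (a := 1 - (wordNat dig s + 1) / B ^ s.length)
      (s := (wordNat dig s + 1) / B ^ s.length) ?_
    have heq : wordMap dig s 1 = (wordNat dig s + 1) / B ^ s.length := wordMap_eq dig s 1
    push_cast
    rw [← heq, mul_div_cancel₀ _ hpos.ne']
    ring
  · exact div_nonneg (by linarith) hpos.le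
  · exact (div_le_one hpos).2 (by linarith)
  · rw [rightMap, mul_div_cancel₀ _ hpos.ne']
    ring_nf

theorem exists_wordMap_of_mem {x : ℝ} (hB : 0 < B) (hx : x ∈ IrrUnit) (h0 : wordMap dig s 0 < x)
    (h1 : x < wordMap dig s 1) : ∃ t ∈ IrrUnit, x = wordMap dig s t := by
  have hpos : (0 : ℝ) < B ^ s.length := by positivity
  rw [wordMap_eq, div_lt_iff₀ hpos] at h0
  rw [wordMap_eq, lt_div_iff₀ hpos] at h1
  have heq : x = wordMap dig s (x * B ^ s.length - wordNat dig s) := by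
    rw [wordMap_eq]
    field_simp
    ring
  exact ⟨_, mem_irrUnit_of_wordMap dig ⟨by linarith, by linarith⟩ (heq ▸ hx), heq⟩

theorem keptPoints_le (hc : IsHoledCode R H m) (hB : 0 < B) (hs : ¬ WordMatch R H s) :
    keptPoints dig R H m ≤ gifsImage (matchGifs dig sep s hc) (keptPoints dig R H m) := by
  have hword : ∀ {q j : Fin 3} {u v : List A} {x y : ℝ},
      (EdgeWords R H m sep q j u v ∨ (q = 0 ∧ j = 1 ∧ u = sep :: s ∧ v = [sep])) →
      !₂[x, y] ∈ keptPoints dig R H m j → !₂[wordMap dig u x, wordMap dig v y] ∈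
        gifsImage (matchGifs dig sep s hc) (keptPoints dig R H m) q := fun h hp =>
    (mem_gifsImage_matchGifs dig sep s hc).2 (.inl ⟨_, _, _, h, _, hp, rfl⟩)
  intro q p hp
  rw [eq_toLp p] at hp ⊢
  obtain ⟨hx, hy, h1, h2⟩ := (mem_keptPoints dig).1 hp
  generalize p 0 = x at *
  generalize p 1 = y at *
  fin_cases q
  · obtain ⟨a, x₁, hx₁, rfl⟩ := exists_wordMap_singleton dig hB hx
    obtain ⟨b, y₁, hy₁, rfl⟩ := exists_wordMap_singleton dig hB hy
    by_cases hab : a ≠ sep ∨ b ≠ sep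
    · exact hword (.inl (.tile hab)) ⟨hx₁, hy₁, by simp, by simp⟩
    push Not at hab
    obtain ⟨rfl, rfl⟩ := hab
    by_cases hr : MissedRule dig R H m x₁ y₁
    swap
    · exact hword (.inl .rules) ⟨hx₁, hy₁, by simp, fun _ => hr⟩
    rcases le_or_gt x₁ (wordMap dig s 0) with hl | hl
    · obtain ⟨t, ht, h⟩ := exists_leftMap dig b s hx₁ hl
      exact (mem_gifsImage_matchGifs dig b s hc).2 (.inr ⟨rfl, !₂[t, y₁],
        ⟨ht, hy₁, by simp, by simp⟩, .inl (by rw [h]; rfl)⟩)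
    rcases le_or_gt (wordMap dig s 1) x₁ with hl' | hl'
    · obtain ⟨t, ht, h⟩ := exists_rightMap dig b s hx₁ hl'
      exact (mem_gifsImage_matchGifs dig b s hc).2 (.inr ⟨rfl, !₂[t, y₁],
        ⟨ht, hy₁, by simp, by simp⟩, .inr (by rw [h]; rfl)⟩)
    obtain ⟨x₂, hx₂, rfl⟩ := exists_wordMap_of_mem dig s hB hx₁ hl hl'
    refine hword (.inr ⟨rfl, rfl, rfl, rfl⟩) (x := x₂) ⟨hx₂, hy₁, fun _ hd => hs ?_, by simp⟩
    obtain ⟨w, z, l, hg, hH, t, ht, t', ht', hxt, rfl⟩ := hr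
    obtain ⟨z', hz', t₁, ht₁, t₂, ht₂, h₁, h₂⟩ := hd
    change x₂ = _ at h₁
    change wordMap dig (z ++ [m]) t' = _ at h₂
    have hzz := eq_of_comparable_append (hc.notMem_wordGen_right hg) hz'
      (prefixComparable_of_wordMap_eq dig ht' ht₂ h₂)
    subst hzz h₁
    rw [← wordMap_append, ← List.append_assoc] at hxt
    exact ⟨w, z, l, hg, hH, prefix_of_comparable_append
      (by simp [hc.notMem_wordGen_left hg, hc.notMem_hole hH])
      (prefixComparable_of_wordMap_eq dig ht ht₁ hxt.symm)⟩
  · have h1 := h1 rfl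
    obtain ⟨a, x₁, hx₁, rfl⟩ := exists_wordMap_singleton dig hB hx
    obtain ⟨b, y₁, hy₁, rfl⟩ := exists_wordMap_singleton dig hB hy
    by_cases hab : a = b
    · subst hab
      have ham : a ≠ m := fun h => h1 ⟨[], by simp, x₁, hx₁, y₁, hy₁, by simp [h], by simp [h]⟩
      refine hword (.inl (.diag ham)) ⟨hx₁, hy₁, fun _ => ?_, by simp⟩
      rintro ⟨z, hz, t, ht, t', ht', hxt, hyt⟩
      change x₁ = _ at hxt
      change y₁ = _ at hyt
      subst hxt hyt
      exact h1 ⟨a :: z, by simp [hz, ham.symm], t, ht, t', ht', rfl, rfl⟩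
    · exact hword (.inl (.offDiag hab)) ⟨hx₁, hy₁, by simp, by simp⟩
  · have h2 := h2 rfl
    obtain ⟨u, hu, x₁, hx₁, hux⟩ := exists_wordMap_length dig hB 3 hx
    obtain ⟨v, hv, y₁, hy₁, hvy⟩ := exists_wordMap_length dig hB 3 hy
    by_cases hr : ∃ l r, R l r ∧ l <+: u ∧ r <+: v
    · obtain ⟨l, r, hr, ⟨u', rfl⟩, ⟨v', rfl⟩⟩ := hr
      rw [wordMap_append] at hux hvy
      subst hux hvy
      refine hword (.inl (.rule hr)) ⟨wordMap_mem_irrUnit dig u' hx₁, wordMap_mem_irrUnit dig v' hy₁,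
        by simp, fun _ => ?_⟩
      rintro ⟨w, z, l', hg, hl, t, ht, t', ht', hxt, hyt⟩
      change wordMap dig u' x₁ = _ at hxt
      change wordMap dig v' y₁ = _ at hyt
      exact h2 ⟨_, _, l', .cons hr hg, hl, t, ht, t', ht',
        by rw [hxt, ← wordMap_append, List.append_assoc],
        by rw [hyt, ← wordMap_append, List.append_assoc]⟩
    by_cases hh : ∃ l, H l ∧ l <+: u ∧ [m] <+: v
    · obtain ⟨l, hl, ⟨u', rfl⟩, ⟨v', rfl⟩⟩ := hh
      rw [wordMap_append] at hux hvy
      exact absurd ⟨[], [], l, .nil, hl, _, wordMap_mem_irrUnit dig u' hx₁, _,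
        wordMap_mem_irrUnit dig v' hy₁, hux, hvy⟩ h2
    · push Not at hr hh
      subst hux hvy
      exact hword (.inl (.rest hu hv (fun l r h h' => hr l r h h'.1 h'.2)
        (fun l h h' => hh l h h'.1 h'.2))) ⟨hx₁, hy₁, by simp, by simp⟩

theorem unitSquare_subset_closure {S : Set (EuclideanSpace ℝ (Fin 2))}
    (hS : ∀ x ∈ IrrUnit, ∀ y ∈ IrrUnit, !₂[x, y] ∈ S) : UnitSquare ⊆ closure S := by
  have hI : Icc (0 : ℝ) 1 ⊆ closure IrrUnit := by
    rw [← closure_Ioo zero_ne_one]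
    refine closure_minimal ?_ isClosed_closure
    refine (dense_irrational.open_subset_closure_inter isOpen_Ioo).trans (closure_mono ?_)
    exact fun x hx => ⟨hx.2, Ioo_subset_Icc_self hx.1⟩
  intro p hp
  have hg : Continuous fun a : ℝ × ℝ => (!₂[a.1, a.2] : EuclideanSpace ℝ (Fin 2)) := by
    fun_prop
  have hmem : (p 0, p 1) ∈ closure (IrrUnit ×ˢ IrrUnit) := by
    rw [closure_prod_eq]
    exact ⟨hI (hp 0), hI (hp 1)⟩
  rw [eq_toLp p]
  refine closure_mono ?_ (image_closure_subset_closure_image hg ⟨_, hmem, rfl⟩)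
  rintro _ ⟨a, ha, rfl⟩
  exact hS _ ha.1 _ ha.2

theorem IsGifsAttractor.le_unitSquare (hc : IsHoledCode R H m) (hm : sep ≠ m)
    {X : Fin 3 → Set (EuclideanSpace ℝ (Fin 2))} (hX : IsGifsAttractor (matchGifs dig sep s hc) X) :
    X ≤ fun _ => UnitSquare :=
  subset_of_subset_gifsImage (gifsWF_matchGifs dig sep s hc hm).1 (fun q => (hX.2 q).le)
    (fun q => (hX.1 q).2.isBounded) (gifsImage_unitSquare_le dig sep s hc)
    (fun _ => isCompact_unitSquare.isClosed) (fun _ => ⟨0, fun i => by simp⟩)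

theorem IsGifsAttractor.eq_unitSquare (hc : IsHoledCode R H m) (hm : sep ≠ m)
    (hs : ¬ WordMatch R H s) {X : Fin 3 → Set (EuclideanSpace ℝ (Fin 2))}
    (hX : IsGifsAttractor (matchGifs dig sep s hc) X) : X 0 = UnitSquare := by
  refine Subset.antisymm (hX.le_unitSquare dig sep s hc hm 0) ?_
  have hle : keptPoints dig R H m ≤ X := by
    refine subset_of_subset_gifsImage (gifsWF_matchGifs dig sep s hc hm).1
      (keptPoints_le dig sep s hc (one_lt_base dig hm).le hs)
      (fun q => isCompact_unitSquare.isBounded.subset fun p hp i => ?_) (fun q => (hX.2 q).ge)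
      (fun q => (hX.1 q).2.isClosed) (fun q => (hX.1 q).1)
    fin_cases i
    exacts [hp.1.2, hp.2.1.2]
  refine (unitSquare_subset_closure (S := X 0) fun x hx y hy => hle 0 ?_).trans
    (hX.1 0).2.isClosed.closure_eq.le
  exact ⟨hx, hy, by simp, by simp⟩

theorem IsGifsAttractor.exists_edge (hc : IsHoledCode R H m) (hm : sep ≠ m)
    {X : Fin 3 → Set (EuclideanSpace ℝ (Fin 2))} (hX : IsGifsAttractor (matchGifs dig sep s hc) X)
    {q : Fin 3} {x y : ℝ} (hx : x ∈ IrrUnit) (hy : y ∈ IrrUnit) (h : !₂[x, y] ∈ X q) :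
    (∃ j u v, (EdgeWords R H m sep q j u v ∨ (q = 0 ∧ j = 1 ∧ u = sep :: s ∧ v = [sep])) ∧
      ∃ x' ∈ IrrUnit, ∃ y' ∈ IrrUnit, !₂[x', y'] ∈ X j ∧
        x = wordMap dig u x' ∧ y = wordMap dig v y') ∨
    (q = 0 ∧ ∃ t ∈ Icc (0 : ℝ) 1, x = leftMap dig sep s t ∨ x = rightMap dig sep s t) := by
  have hle := hX.le_unitSquare dig sep s hc hm
  rw [show X q = _ from hX.2 q] at h
  rcases (mem_gifsImage_matchGifs dig sep s hc).1 h with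
    ⟨j, u, v, hw, p', hp', he⟩ | ⟨rfl, p', hp', he⟩
  · have h0 : x = wordMap dig u (p' 0) := congrFun (congrArg WithLp.ofLp he) 0
    have h1 : y = wordMap dig v (p' 1) := congrFun (congrArg WithLp.ofLp he) 1
    exact .inl ⟨j, u, v, hw, p' 0, mem_irrUnit_of_wordMap dig (hle _ hp' 0) (h0 ▸ hx), p' 1,
      mem_irrUnit_of_wordMap dig (hle _ hp' 1) (h1 ▸ hy), eq_toLp p' ▸ hp', h0, h1⟩
  · refine .inr ⟨rfl, p' 0, hle _ hp' 0, ?_⟩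
    rcases he with he | he
    · exact .inl (congrFun (congrArg WithLp.ofLp he) 0)
    · exact .inr (congrFun (congrArg WithLp.ofLp he) 0)

theorem IsGifsAttractor.not_missedDiag (hc : IsHoledCode R H m) (hm : sep ≠ m)
    {X : Fin 3 → Set (EuclideanSpace ℝ (Fin 2))} (hX : IsGifsAttractor (matchGifs dig sep s hc) X)
    {z : List A} (hz : m ∉ z) {t t' : ℝ} (ht : t ∈ IrrUnit) (ht' : t' ∈ IrrUnit) :
    !₂[wordMap dig (z ++ [m]) t, wordMap dig (z ++ [m]) t'] ∉ X 1 := by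
  induction z with
  | nil =>
    intro h
    rcases hX.exists_edge dig sep s hc hm (wordMap_mem_irrUnit dig _ ht)
      (wordMap_mem_irrUnit dig _ ht') h with ⟨j, u, v, hw | hw, x', hx', y', hy', -, h1, h2⟩ | h
    · have h1 := prefixComparable_of_wordMap_eq dig ht hx' h1
      have h2 := prefixComparable_of_wordMap_eq dig ht' hy' h2
      generalize hq : (1 : Fin 3) = q at hw
      cases hw <;> simp [PrefixComparable] at hq h1 h2 <;> grind
    · simp at hw
    · simp at h
  | cons a z ih =>
    intro h
    rcases hX.exists_edge dig sep s hc hm (wordMap_mem_irrUnit dig _ ht)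
      (wordMap_mem_irrUnit dig _ ht') h with ⟨j, u, v, hw | hw, x', hx', y', hy', hX', h1, h2⟩ | h
    · have h3 := prefixComparable_of_wordMap_eq dig ht hx' h1
      have h4 := prefixComparable_of_wordMap_eq dig ht' hy' h2
      generalize hq : (1 : Fin 3) = q at hw
      cases hw with
      | @diag b ha =>
        obtain rfl : a = b := by
          simp [PrefixComparable] at h3
          grind
        have hinj := (wordMap_strictMono dig [a]).injective
        have h1 := hinj ((wordMap_append dig [a] (z ++ [m]) t).symm.trans h1)
        have h2 := hinj ((wordMap_append dig [a] (z ++ [m]) t').symm.trans h2)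
        rw [← h1, ← h2] at hX'
        exact ih (by simp at hz; exact hz.2) hX'
      | offDiag hab =>
        simp [PrefixComparable] at h3 h4
        grind
      | _ => simp at hq
    · simp at hw
    · simp at h

theorem IsGifsAttractor.not_missedRule (hc : IsHoledCode R H m) (hm : sep ≠ m)
    {X : Fin 3 → Set (EuclideanSpace ℝ (Fin 2))} (hX : IsGifsAttractor (matchGifs dig sep s hc) X)
    {w z l : List A} (hg : WordGen R w z) (hl : H l) {t t' : ℝ} (ht : t ∈ IrrUnit)
    (ht' : t' ∈ IrrUnit) : !₂[wordMap dig (w ++ l) t, wordMap dig (z ++ [m]) t'] ∉ X 2 := by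
  have hshort : ∀ {l u w : List A}, l.length ≤ 3 → u.length = 3 →
      PrefixComparable (l ++ w) u → l <+: u := by
    intro l u w hl hu h
    rcases h with h | h
    · exact (List.prefix_append l w).trans h
    · exact List.prefix_of_prefix_length_le (List.prefix_append l w) h (by omega)
  induction hg with
  | nil =>
    intro h
    rcases hX.exists_edge dig sep s hc hm (wordMap_mem_irrUnit dig _ ht)
      (wordMap_mem_irrUnit dig _ ht') h with ⟨j, u, v, hw | hw, x', hx', y', hy', -, h1, h2⟩ | h
    · have h1 := prefixComparable_of_wordMap_eq dig ht hx' h1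
      have h2 := prefixComparable_of_wordMap_eq dig ht' hy' h2
      generalize hq : (2 : Fin 3) = q at hw
      cases hw with
      | rule hr =>
        have h3 := prefix_of_comparable_append (v := []) (hc.notMem_right hr) (Or.symm h2)
        exact hc.right_ne_nil hr (List.prefix_nil.1 h3)
      | rest hu hv _ hh =>
        refine hh l hl ⟨hshort (w := []) (hc.hole_length_le hl) hu (by simpa using h1), ?_⟩
        exact hshort (w := []) (by simp) hv (by simpa using h2)
      | _ => simp at hq
    · simp at hw
    · simp at h
  | @cons l₀ r₀ w z hr hg ih =>
    intro h
    rw [List.append_assoc, List.append_assoc] at h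
    rcases hX.exists_edge dig sep s hc hm (wordMap_mem_irrUnit dig _ ht)
      (wordMap_mem_irrUnit dig _ ht') h with ⟨j, u, v, hw | hw, x', hx', y', hy', hX', h1, h2⟩ | h
    · generalize hq : (2 : Fin 3) = q at hw
      cases hw with
      | rule hr' =>
        rw [wordMap_append] at h1 h2
        have h3 := prefixComparable_of_wordMap_eq dig (wordMap_mem_irrUnit dig _ ht) hx' h1
        have h4 := prefixComparable_of_wordMap_eq dig (wordMap_mem_irrUnit dig _ ht') hy' h2
        obtain ⟨rfl, rfl⟩ := hc.unique hr hr' h3 h4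
        have h1 := (wordMap_strictMono dig l₀).injective h1
        have h2 := (wordMap_strictMono dig r₀).injective h2
        rw [← h1, ← h2] at hX'
        exact ih hX'
      | rest hu hv hh _ =>
        have h1 := prefixComparable_of_wordMap_eq dig ht hx' h1
        have h2 := prefixComparable_of_wordMap_eq dig ht' hy' h2
        exact hh _ _ hr ⟨hshort (hc.left_length_le hr) hu h1,
          hshort (hc.right_length_le hr) hv h2⟩
      | _ => simp at hq
    · simp at hw
    · simp at h

theorem IsGifsAttractor.ne_unitSquare (hc : IsHoledCode R H m) (hm : sep ≠ m)
    (hs : WordMatch R H s) {X : Fin 3 → Set (EuclideanSpace ℝ (Fin 2))}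
    (hX : IsGifsAttractor (matchGifs dig sep s hc) X) : X 0 ≠ UnitSquare := by
  obtain ⟨w, z, l, hg, hl, hp⟩ := hs
  obtain ⟨t, ht⟩ := irrUnit_nonempty
  have hx := wordMap_mem_irrUnit dig (s ++ (z ++ [m])) ht
  have hy := wordMap_mem_irrUnit dig (z ++ [m]) ht
  intro heq
  have hmem : !₂[wordMap dig [sep] (wordMap dig (s ++ (z ++ [m])) t),
      wordMap dig [sep] (wordMap dig (z ++ [m]) t)] ∈ X 0 := by
    rw [heq]
    intro i
    fin_cases i
    exacts [(wordMap_mem_irrUnit dig [sep] hx).2, (wordMap_mem_irrUnit dig [sep] hy).2]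
  have hinj := (wordMap_strictMono dig [sep]).injective
  rcases hX.exists_edge dig sep s hc hm (wordMap_mem_irrUnit dig _ hx)
    (wordMap_mem_irrUnit dig _ hy) hmem with
    ⟨j, u, v, hw | ⟨-, rfl, rfl, rfl⟩, x', hx', y', hy', hX', h1, h2⟩ | ⟨-, t', ht', h | h⟩
  · have h3 := prefixComparable_of_wordMap_eq dig hx hx' h1
    have h4 := prefixComparable_of_wordMap_eq dig hy hy' h2
    generalize hq : (0 : Fin 3) = q at hw
    cases hw with
    | tile h => simp [PrefixComparable] at h3 h4; grind
    | rules =>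
      have h1 := hinj h1
      have h2 := hinj h2
      obtain ⟨r, hr⟩ := hp
      rw [← List.append_assoc, ← hr, List.append_assoc, wordMap_append] at h1
      rw [← h1, ← h2] at hX'
      exact hX.not_missedRule dig sep s hc hm hg hl (wordMap_mem_irrUnit dig _ ht) ht hX'
    | _ => simp at hq
  · have h1 := hinj (h1.trans (wordMap_append dig [sep] s x'))
    have h2 := hinj h2
    rw [wordMap_append] at h1
    have h1 := (wordMap_strictMono dig s).injective h1
    rw [← h1, ← h2] at hX'
    exact hX.not_missedDiag dig sep s hc hm (hc.notMem_wordGen_right hg) ht ht hX'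
  · have h := hinj h
    rw [wordMap_append] at h
    have h1 : wordMap dig s 0 < wordMap dig s (wordMap dig (z ++ [m]) t) :=
      wordMap_strictMono dig s (IrrUnit.pos hy)
    rw [h, wordMap_eq, add_zero] at h1
    have h2 : (0 : ℝ) ≤ wordNat dig s / B ^ s.length := by positivity
    nlinarith [ht'.2]
  · have h := hinj h
    rw [wordMap_append] at h
    have h1 : wordMap dig s (wordMap dig (z ++ [m]) t) < wordMap dig s 1 :=
      wordMap_strictMono dig s (IrrUnit.lt_one hy)
    rw [h] at h1
    have h2 := (wordMap_mem_Icc dig s (x := 1) (by simp)).2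
    nlinarith [ht'.1]

/-- The attractor of the system is the unit square if and only if there is no match. -/
theorem forall_attractor_eq_unitSquare_iff (hc : IsHoledCode R H m) (hm : sep ≠ m) :
    (∀ X, IsGifsAttractor (matchGifs dig sep s hc) X → X 0 = UnitSquare) ↔
      ¬ WordMatch R H s := by
  refine ⟨fun h hs => ?_, fun hs X hX => hX.eq_unitSquare dig sep s hc hm hs⟩
  obtain ⟨X, hX⟩ := exists_isGifsAttractor (gifsWF_matchGifs dig sep s hc hm)
    (gifsImage_unitSquare_le dig sep s hc) (fun _ => isCompact_unitSquare)
    (fun _ => ⟨0, fun i => by simp⟩)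
  exact hX.ne_unitSquare dig sep s hc hm hs (h X hX)

end Match

/-! ### Computability of the reduction -/

section Reduction

open Turing TMLetter

variable {A : Type} {B : ℕ} (dig : A ≃ Fin B)

theorem Primrec.nat_pow_base (B : ℕ) : Primrec fun k : ℕ => B ^ k :=
  (Primrec.nat_rec₁ 1 (Primrec.nat_mul.comp₂ (Primrec₂.right)
    (Primrec.const B).to₂)).of_eq fun k => by
      induction k with
      | zero => rfl
      | succ k ih => rw [pow_succ, ← ih]

theorem primrec_vec₂ {α σ : Type*} [Primcodable α] [Primcodable σ] {f g : α → σ}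
    (hf : Primrec f) (hg : Primrec g) : Primrec fun a => ![f a, g a] := by
  have h : Primrec₂ fun (i : Fin 2) a => ![f a, g a] i := by
    refine Primrec.fin_curry₁.2 fun i => ?_
    match i with
    | 0 => exact hf
    | 1 => exact hg
  exact Primrec.fin_curry.2 h.swap

theorem primrec_diagEdge (i j : Fin 3) {a s b t : ℕ → ℚ} (ha : Primrec a) (hs : Primrec s)
    (hb : Primrec b) (ht : Primrec t) :
    Primrec fun k => diagEdge i j (a k) (s k) (b k) (t k) :=
  (Primrec.const i).pair ((Primrec.const j).pair
    ((primrec_vec₂ (primrec_vec₂ ha (Primrec.const 0)) (primrec_vec₂ (Primrec.const 0) hb)).pair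
      (primrec_vec₂ hs ht)))

theorem wordNat_append (u v : List A) :
    wordNat dig (u ++ v) = wordNat dig u * B ^ v.length + wordNat dig v := by
  rw [← wordNat_foldl, wordNat, wordNat, List.foldl_append]

theorem primrec_wordNat_append_replicate (u : List A) (d : A) (v : List A) :
    Primrec fun k => wordNat dig (u ++ List.replicate k d ++ v) := by
  have h1 : Primrec fun k => wordNat dig (u ++ List.replicate k d) := by
    refine (Primrec.nat_rec₁ (wordNat dig u) (Primrec.nat_add.comp₂ (Primrec.nat_mul.comp₂
      (Primrec₂.right) (Primrec.const B).to₂) (Primrec.const (dig d : ℕ)).to₂)).of_eq fun k => ?_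
    induction k with
    | zero => simp
    | succ k ih =>
      rw [List.replicate_succ', ← List.append_assoc, wordNat_append, ← ih]
      simp [wordNat]
  refine (Primrec.nat_add.comp (Primrec.nat_mul.comp h1 (Primrec.const (B ^ v.length)))
    (Primrec.const (wordNat dig v))).of_eq fun k => ?_
  exact (wordNat_append dig _ v).symm

theorem primrec_matchGifs {R : List A → List A → Prop} {H : List A → Prop} {m sep : A}
    (hc : IsHoledCode R H m) (u : List A) (d : A) (v : List A) :
    Primrec fun k => matchGifs dig sep (u ++ List.replicate k d ++ v) hc := by
  have hB := base_pos_of_letter dig sep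
  have hlen : ∀ k, (u ++ List.replicate k d ++ v).length = k + (u.length + v.length) := by
    intro k
    simp
    omega
  have hpow : ∀ n, Primrec fun k => B ^ ((u ++ List.replicate k d ++ v).length + n) := fun n =>
    ((Primrec.nat_pow_base B).comp (Primrec.nat_add.comp Primrec.id
      (Primrec.const (u.length + v.length + n)))).of_eq fun k => by
        rw [hlen, id, ← add_assoc]
  have hnat := primrec_wordNat_append_replicate dig u d v
  have hnat' := primrec_wordNat_append_replicate dig (sep :: u) d v
  have hpos : ∀ n k, 0 < B ^ ((u ++ List.replicate k d ++ v).length + n) := fun n k => by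
    positivity
  have hinv : Primrec fun _ : ℕ => ((1 : ℕ) : ℚ) / (B : ℕ) := Primrec.const _
  have hsep : Primrec fun _ : ℕ => ((dig sep : ℕ) : ℚ) / (B : ℕ) := Primrec.const _
  refine Primrec.list_cons.comp ?_ (Primrec.list_cons.comp ?_ (Primrec.list_cons.comp ?_
    (Primrec.const _)))
  · exact primrec_diagEdge 0 1 (Primrec.rat_div (Primrec.const 1) (hpow 1) (hpos 1))
      (Primrec.rat_div hnat' (hpow 1) (hpos 1)) (Primrec.const _) (Primrec.const _)
  · exact primrec_diagEdge 0 0 (Primrec.rat_div hnat (hpow 1) (hpos 1)) hsep hinv hsep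
  · exact primrec_diagEdge 0 0 (Primrec.rat_div (Primrec.nat_sub.comp (hpow 0)
      (Primrec.succ.comp hnat)) (hpow 1) (hpos 1))
      (Primrec.rat_div (Primrec.succ.comp hnat') (hpow 1) (hpos 1)) hinv hsep

end Reduction

/-- It is undecidable whether the attractor component `X_q` of a 2-dimensional rational
affine GIFS with 3 vertices (every vertex having an outgoing edge) equals `[0,1]²`. -/
theorem undecidable_eqUnitSquare_gifs :
    ¬ ∃ f : List GifsEdge × Fin 3 → Bool, Computable f ∧
      ∀ inst : List GifsEdge × Fin 3, GifsWF inst.1 →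
        (f inst = true ↔
          ∀ X : Fin 3 → Set (EuclideanSpace ℝ (Fin 2)),
            IsGifsAttractor inst.1 X → X inst.2 = UnitSquare) := by
  rintro ⟨f, hf, hspec⟩
  obtain ⟨Γ, Q, _, _, _, _, M, b, c, d, hM⟩ := exists_undecidable_TM0
  have hm : (TMLetter.sep : TMLetter Γ Q) ≠ TMLetter.mark := by simp
  have hc := isHoledCode_tmRule M
  obtain ⟨B, ⟨dig⟩⟩ := Finite.exists_equiv_fin (TMLetter Γ Q)
  let u : List (TMLetter Γ Q) :=
    [TMLetter.tape default, TMLetter.state default, TMLetter.tape b, TMLetter.tape c]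
  let v : List (TMLetter Γ Q) := [TMLetter.tape default, TMLetter.sep, TMLetter.tape default]
  refine hM (ComputablePred.computable_iff.2 ⟨fun k =>
    !f (matchGifs dig TMLetter.sep (u ++ List.replicate k (TMLetter.tape d) ++ v) hc, 0), ?_, ?_⟩)
  · exact Primrec.not.to_comp.comp (hf.comp ((primrec_matchGifs dig hc u _ v).to_comp.pair
      (Computable.const 0)))
  · funext k
    have h : f (matchGifs dig TMLetter.sep (u ++ List.replicate k (TMLetter.tape d) ++ v) hc, 0) =
        true ↔ _ := (hspec (_, 0) (gifsWF_matchGifs dig TMLetter.sep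
      (u ++ List.replicate k (TMLetter.tape d) ++ v) hc hm)).trans
      (forall_attractor_eq_unitSquare_iff dig TMLetter.sep _ hc hm)
    have hw : u ++ List.replicate k (TMLetter.tape d) ++ v =
        tmWord [default] default b (c :: List.replicate k d ++ [default]) ++
          [TMLetter.sep, TMLetter.tape default] := by
      simp [u, v, tmWord]
    rw [eq_iff_iff, ← wordMatch_init_iff M b (c :: List.replicate k d), ← hw,
      Bool.not_eq_true', ← Bool.not_eq_true, h, not_not]
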